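/- (Gehring lemma with tail.) Let 1 < s < n + 2 and let g, f, h be nonnegative functions on ℝ^{n+1} with g², f², h^s ∈ L¹(ℝ^{n+1}). Suppose there is A ≥ 1 such that for every parabolic cylinder B = I × Q (with ℓ(I) = r(Q)²) one has (⨍⨍_B g² dμ)^{1/2} ≤ A·a_g(B) + (a_{f²}(B))^{1/2} + r(B)(a_{h^s}(B))^{1/s}. Let p > 2 and suppose there are α, β ≥ 0 and q_α, q_β > 1 with 2α + β = s and 1/q_α − α = s/p = 1/q_β − β/n. If p − 2 > 0 is sufficiently small (depending on A and dimension), then ‖g‖_{L^p(ℝ^{n+1})} ≲ ‖f‖_{L^p(ℝ^{n+1})} + ‖h^s‖_{L^{q_α}(ℝ; L^{q_β}(ℝⁿ))}^{1/s}, with implicit constant depending on A, α, β, q_α, q_β and dimension. -/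

import Mathlib

open MeasureTheory Real Complex Filter Set Metric
open scoped FourierTransform Topology ENNReal NNReal

noncomputable section

/-- Spatial variable: `ℝⁿ`. -/
abbrev Spc (n : ℕ) := Fin n → ℝ
/-- Space-time point `(t,x) ∈ ℝ^{1+n}`. -/
abbrev Pt (n : ℕ) := ℝ × Spc n
/-- Values `ℂᵐ`. -/
abbrev Val (m : ℕ) := Fin m → ℂ
/-- Gradient-type values `ℂ^{nm}`: index `i` for the spatial direction, `α` for the component. -/
abbrev Grad (n m : ℕ) := Fin n → Fin m → ℂ

variable {n m : ℕ}

/-- Hermitian dot product `v ⋅ conj w` on `ℂ^{nm}`. -/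
def gdot (v w : Grad n m) : ℂ := ∑ i, ∑ α, v i α * (starRingEnd ℂ) (w i α)

/-- Hermitian dot product `v ⋅ conj w` on `ℂᵐ`. -/
def vdot (v w : Val m) : ℂ := ∑ α, v α * (starRingEnd ℂ) (w α)

/-- Euclidean norm on `ℂ^{nm}`. -/
def gnorm (G : Grad n m) : ℝ := Real.sqrt (∑ i, ∑ α, ‖G i α‖ ^ 2)

/-- Euclidean norm on `ℂᵐ`. -/
def vnorm (v : Val m) : ℝ := Real.sqrt (∑ α, ‖v α‖ ^ 2)

/-- Spatial gradient of a (smooth) function on space-time. -/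
def tgrad (φ : Pt n → Val m) (z : Pt n) : Grad n m :=
  fun i α => fderiv ℝ φ z ((0 : ℝ), Pi.single i (1:ℝ)) α

/-- Spatial gradient of a (smooth) function on space. -/
def tgradx (v : Spc n → Val m) (x : Spc n) : Grad n m :=
  fun i α => fderiv ℝ v x (Pi.single i (1:ℝ)) α

/-- Time derivative `∂_t φ` of a smooth function on space-time. -/
def tdt (φ : Pt n → Val m) (z : Pt n) : Val m := fun α => fderiv ℝ φ z ((1:ℝ), (0 : Spc n)) α

/-- Scalar spatial partial derivative `∂_i φ`. -/
def tdx (φ : Pt n → ℂ) (i : Fin n) (z : Pt n) : ℂ := fderiv ℝ φ z ((0:ℝ), Pi.single i (1:ℝ))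

/-- Scalar time derivative `∂_t φ`. -/
def tdtc (φ : Pt n → ℂ) (z : Pt n) : ℂ := fderiv ℝ φ z ((1:ℝ), (0 : Spc n))

/-- Test functions for a space-time domain `Ω`. -/
def IsTest (Ω : Set (Pt n)) (φ : Pt n → Val m) : Prop :=
  ContDiff ℝ (⊤:ℕ∞) φ ∧ HasCompactSupport φ ∧ tsupport φ ⊆ Ω

/-- `Du` is the weak (distributional) spatial gradient of `u` on `Ω`. -/
def IsWeakGrad (Ω : Set (Pt n)) (u : Pt n → Val m) (Du : Pt n → Grad n m) : Prop :=
  ∀ φ : Pt n → ℂ, ContDiff ℝ (⊤:ℕ∞) φ → HasCompactSupport φ → tsupport φ ⊆ Ω →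
    ∀ i α, ∫ z in Ω, u z α * tdx φ i z = - ∫ z in Ω, Du z i α * φ z

/-- Coefficients bounded (in `L^∞`) by `M`. -/
def BddCoeff (A : Pt n → (Grad n m →L[ℂ] Grad n m)) (M : ℝ) : Prop := ∀ z, ‖A z‖ ≤ M

/-- Zero-order coefficients bounded by `M`. -/
def BddCoeff0 (B : Pt n → (Val m →L[ℂ] Val m)) (M : ℝ) : Prop := ∀ z, ‖B z‖ ≤ M

/-- The Gårding inequality for `A`, with constants `lam > 0`, `kap ≥ 0`, uniformly in `t`,
tested on smooth compactly supported functions (dense in `W^{1,2}(ℝⁿ;ℂᵐ)`). -/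
def Garding (A : Pt n → (Grad n m →L[ℂ] Grad n m)) (lam kap : ℝ) : Prop :=
  ∀ t : ℝ, ∀ v : Spc n → Val m, ContDiff ℝ (⊤:ℕ∞) v → HasCompactSupport v →
    lam * (∫ x, gnorm (tgradx v x) ^ 2) - kap * (∫ x, vnorm (v x) ^ 2)
      ≤ (∫ x, gdot (A (t, x) (tgradx v x)) (tgradx v x)).re

/-- `u` (with weak spatial gradient `Du`) is a weak solution of
`∂_t u − div A ∇u = f + div F` on `Ω`. -/
def IsWeakSol (Ω : Set (Pt n)) (A : Pt n → (Grad n m →L[ℂ] Grad n m))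
    (u : Pt n → Val m) (Du : Pt n → Grad n m)
    (f : Pt n → Val m) (F : Pt n → Grad n m) : Prop :=
  IsWeakGrad Ω u Du ∧
  ∀ φ : Pt n → Val m, IsTest Ω φ →
    (∫ z in Ω, gdot (A z (Du z)) (tgrad φ z)) - (∫ z in Ω, vdot (u z) (tdt φ z))
      = (∫ z in Ω, vdot (f z) (φ z)) - (∫ z in Ω, gdot (F z) (tgrad φ z))

/-- Local `L^p` integrability (of a scalar magnitude function) on `Ω`. -/
def MemLocP (Ω : Set (Pt n)) (g : Pt n → ℝ) (p : ℝ) : Prop :=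
  ∀ K : Set (Pt n), IsCompact K → K ⊆ Ω → IntegrableOn (fun z => |g z| ^ p) K

/-- The open interval of length `ℓ` centered at `t₀`. -/
def tIv (t₀ ℓ : ℝ) : Set ℝ := Set.Ioo (t₀ - ℓ/2) (t₀ + ℓ/2)

/-- The open parabolic cylinder `I × Q` with `I` centered at `t₀` of length `ℓ` and
`Q` the ball of radius `r` centered at `x₀`. -/
def cylinder (t₀ : ℝ) (x₀ : Spc n) (ℓ r : ℝ) : Set (Pt n) :=
  tIv t₀ ℓ ×ˢ Metric.ball x₀ r

/-- Lower parabolic Sobolev conjugate: `1/p_* = 1/p + 1/(n+2)`. -/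
def pLow (p : ℝ) (n : ℕ) : ℝ := (p⁻¹ + ((n : ℝ) + 2)⁻¹)⁻¹

/-- Upper parabolic Sobolev conjugate: `1/p* = 1/p − 1/(n+2)`. -/
def pUp (p : ℝ) (n : ℕ) : ℝ := (p⁻¹ - ((n : ℝ) + 2)⁻¹)⁻¹

/-- `D_t^{1/2} φ` for a nice function of one (time) variable, via the Fourier
symbol `|τ|^{1/2}`. -/
def halfDerivTest (φ : ℝ → ℂ) : ℝ → ℂ :=
  𝓕⁻ (fun τ : ℝ => (Real.sqrt |τ| : ℂ) * 𝓕 φ τ)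

/-- `H_t φ` for a nice function of one (time) variable, via the Fourier symbol `i sgn τ`. -/
def hilbertTest (φ : ℝ → ℂ) : ℝ → ℂ :=
  𝓕⁻ (fun τ : ℝ => Complex.I * (Real.sign τ : ℂ) * 𝓕 φ τ)

/-- `D` is the half-order time derivative `D_t^{1/2} v`, in the sense of duality with
test functions in the time variable (the symbol `|τ|^{1/2}` is even, so `D_t^{1/2}` is
symmetric for the bilinear pairing). -/
def IsHalfTimeDeriv (v D : Pt n → Val m) : Prop :=
  ∀ φ : ℝ → ℂ, ContDiff ℝ (⊤:ℕ∞) φ → HasCompactSupport φ → ∀ α : Fin m,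
    ∀ᵐ x : Spc n, ∫ t, D (t, x) α * φ t = ∫ t, v (t, x) α * halfDerivTest φ t

/-- `H` is the Hilbert transform `H_t v` in the time variable, in the sense of duality
(`H_t` is skew-symmetric for the bilinear pairing). -/
def IsHilbertPair (v H : Pt n → Val m) : Prop :=
  ∀ φ : ℝ → ℂ, ContDiff ℝ (⊤:ℕ∞) φ → HasCompactSupport φ → ∀ α : Fin m,
    ∀ᵐ x : Spc n, ∫ t, H (t, x) α * φ t = - ∫ t, v (t, x) α * hilbertTest φ t

/-- `D_t^{1/2} φ` of a smooth compactly supported function on space-time,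
computed slice-wise in the time variable. -/
def halfDerivFun (φ : Pt n → ℂ) : Pt n → ℂ :=
  fun z => 𝓕⁻ (fun τ : ℝ => (Real.sqrt |τ| : ℂ) * 𝓕 (fun s => φ (s, z.2)) τ) z.1

/-- Absolute continuity (on all of `ℝ`) of a real function. -/
def AbsCont (g : ℝ → ℝ) : Prop :=
  ∀ ε > (0:ℝ), ∃ δ > (0:ℝ), ∀ (s : Finset ℕ) (a b : ℕ → ℝ),
    (∀ i ∈ s, a i ≤ b i) →
    ((s : Set ℕ).PairwiseDisjoint fun i => Set.Ioo (a i) (b i)) →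
    (∑ i ∈ s, (b i - a i)) < δ → (∑ i ∈ s, |g (b i) - g (a i)|) < ε

/-- The cut-off `χ • u`. -/
def locU (χ : Pt n → ℂ) (u : Pt n → Val m) : Pt n → Val m := fun z α => χ z * u z α

/-- The gradient of `χ u`: `χ ∇u + u ⊗ ∇χ`. -/
def locGrad (χ : Pt n → ℂ) (u : Pt n → Val m) (Du : Pt n → Grad n m) : Pt n → Grad n m :=
  fun z i α => χ z * Du z i α + u z α * tdx χ i z

/-- The right-hand side `f̃ = χ f + (∂_t χ) u − A ∇u · ∇χ − F · ∇χ` appearing after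
localization. -/
def locf (A : Pt n → (Grad n m →L[ℂ] Grad n m)) (χ : Pt n → ℂ)
    (u : Pt n → Val m) (Du : Pt n → Grad n m)
    (f : Pt n → Val m) (F : Pt n → Grad n m) : Pt n → Val m :=
  fun z α => χ z * f z α + tdtc χ z * u z α
    - (∑ i, A z (Du z) i α * tdx χ i z) - (∑ i, F z i α * tdx χ i z)

/-- The right-hand side `F̃ = −A(u ∇χ) + F χ` appearing after localization. -/
def locF (A : Pt n → (Grad n m →L[ℂ] Grad n m)) (χ : Pt n → ℂ)
    (u : Pt n → Val m) (F : Pt n → Grad n m) : Pt n → Grad n m :=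
  fun z i α => - A z (fun j β => u z β * tdx χ j z) i α + F z i α * χ z

/-- The tail functional `a_u(B) = Σ_j 2^{-j-1} ⨍⨍_{4^j I × γ Q} u`. -/
def tailAvg (γ : ℝ) (u : Pt n → ℝ) (t₀ : ℝ) (x₀ : Spc n) (r : ℝ) : ℝ :=
  ∑' j : ℕ, ((2:ℝ)⁻¹) ^ (j+1) * ⨍ z in cylinder t₀ x₀ ((4:ℝ)^j * r^2) (γ * r), u z

/-- An element of the space `E_p = L^p(ℝ;W^{1,p}) ∩ H^{1/2,p}(ℝ;L^p)`: a function
together with its weak spatial gradient, half-order time derivative, and the Hilbert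
transform in time of the latter, all `p`-integrable. -/
structure EpElem (n m : ℕ) (p : ℝ) where
  u : Pt n → Val m
  Du : Pt n → Grad n m
  Dh : Pt n → Val m
  HDh : Pt n → Val m
  grad : IsWeakGrad Set.univ u Du
  half : IsHalfTimeDeriv u Dh
  hilb : IsHilbertPair Dh HDh
  memu : Integrable (fun z => vnorm (u z) ^ p)
  memDu : Integrable (fun z => gnorm (Du z) ^ p)
  memDh : Integrable (fun z => vnorm (Dh z) ^ p)

/-- The `E_p` norm. -/
def EnormP (p : ℝ) (U : EpElem n m p) : ℝ :=
  ((∫ z, vnorm (U.u z) ^ p) + (∫ z, gnorm (U.Du z) ^ p) + (∫ z, vnorm (U.Dh z) ^ p)) ^ (1/p)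

/-- The sesquilinear form of `𝓛 = ∂_t − div A ∇ + κ + 1` on `E_p × E_q`. -/
def LformP {p q : ℝ} (A : Pt n → (Grad n m →L[ℂ] Grad n m)) (kap : ℝ)
    (U : EpElem n m p) (V : EpElem n m q) : ℂ :=
  ∫ z, gdot (A z (U.Du z)) (V.Du z) + vdot (U.HDh z) (V.Dh z)
    + ((kap + 1 : ℝ) : ℂ) * vdot (U.u z) (V.u z)

/-- The action `⟨𝓛 U, φ⟩` on a smooth compactly supported test function `φ`. -/
def LformTest (A : Pt n → (Grad n m →L[ℂ] Grad n m)) (kap : ℝ)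
    (u : Pt n → Val m) (Du : Pt n → Grad n m) (HDh : Pt n → Val m)
    (φ : Pt n → Val m) : ℂ :=
  ∫ z, gdot (A z (Du z)) (tgrad φ z)
    + vdot (HDh z) (fun α => halfDerivFun (fun w => φ w α) z)
    + ((kap + 1 : ℝ) : ℂ) * vdot (u z) (φ z)


/-- The `L^p(ℝ^{n+1})` norm (valued in `ℝ≥0∞`) of a scalar magnitude function. -/
def pnormE (g : Pt n → ℝ) (p : ℝ) : ℝ≥0∞ := eLpNorm g (ENNReal.ofReal p) volume

/-- The mixed norm `‖H‖_{L^{qa}(ℝ; L^{qb}(ℝⁿ))}`, valued in `ℝ≥0∞`. -/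
def mixedNorm (H : Pt n → ℝ) (qa qb : ℝ) : ℝ≥0∞ :=
  (∫⁻ t : ℝ, ((∫⁻ x : Spc n, ENNReal.ofReal |H (t, x)| ^ qb) ^ (1/qb)) ^ qa) ^ (1/qa)


/-- The `ℝ≥0∞`-valued `L^p` average `(⨍⨍_S |g|^p)^{1/p}` over a set of space-time. -/
def avgP (S : Set (Pt n)) (g : Pt n → ℝ) (p : ℝ) : ℝ≥0∞ :=
  (⨍⁻ z in S, ENNReal.ofReal (|g z| ^ p) ∂volume) ^ (1/p)

/-- The `ℝ≥0∞`-valued `L^p` average `(⨍_S |g|^p)^{1/p}` over a set of space. -/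
def avgPx {n : ℕ} (S : Set (Spc n)) (g : Spc n → ℝ) (p : ℝ) : ℝ≥0∞ :=
  (⨍⁻ x in S, ENNReal.ofReal (|g x| ^ p) ∂volume) ^ (1/p)

end

set_option linter.unusedSectionVars false
set_option linter.unusedVariables false

namespace GT

/-- pointwise layer cake -/
lemma lc_pt {p : ℝ} (hp : 0 < p) (w : ℝ≥0∞) :
    ∫⁻ t in Ioi (0:ℝ), ({t : ℝ | ENNReal.ofReal t < w}).indicator
      (fun t => ENNReal.ofReal (p * t ^ (p-1))) t = w ^ p := by
  have hfin : ∀ b : ℝ, 0 ≤ b → ∫⁻ t in Ioi (0:ℝ), ({t : ℝ | ENNReal.ofReal t < ENNReal.ofReal b}).indicator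
      (fun t => ENNReal.ofReal (p * t ^ (p-1))) t = (ENNReal.ofReal b) ^ p := by
    intro b hb
    have hms : MeasurableSet {t : ℝ | ENNReal.ofReal t < ENNReal.ofReal b} :=
      measurableSet_lt ENNReal.measurable_ofReal measurable_const
    rw [lintegral_indicator hms, Measure.restrict_restrict hms]
    have : {t : ℝ | ENNReal.ofReal t < ENNReal.ofReal b} ∩ Ioi 0 = Ioo 0 b := by
      ext t
      simp only [mem_inter_iff, mem_ofPred_eq, mem_Ioi, mem_Ioo]
      constructor
      · rintro ⟨h1, h2⟩
        exact ⟨h2, (ENNReal.ofReal_lt_ofReal_iff'.1 h1).1⟩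
      · rintro ⟨h1, h2⟩
        exact ⟨ENNReal.ofReal_lt_ofReal_iff'.2 ⟨h2, h1.trans h2⟩, h1⟩
    rw [this, restrict_Ioo_eq_restrict_Ioc]
    have hi : IntervalIntegrable (fun t : ℝ => p * t ^ (p-1)) volume 0 b :=
      (intervalIntegral.intervalIntegrable_rpow' (by linarith)).const_mul p
    rw [← ofReal_integral_eq_lintegral_ofReal]
    · rw [← intervalIntegral.integral_of_le hb, intervalIntegral.integral_const_mul,
        integral_rpow (Or.inl (by linarith)), ENNReal.ofReal_rpow_of_nonneg hb hp.le]
      congr 1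
      rw [show p - 1 + 1 = p by ring, Real.zero_rpow hp.ne']
      field_simp; ring
    · exact (intervalIntegrable_iff_integrableOn_Ioc_of_le hb).1 hi
    · filter_upwards [ae_restrict_mem measurableSet_Ioc] with t ht
      have := Real.rpow_nonneg ht.1.le (p-1)
      positivity
  rcases eq_or_ne w ⊤ with rfl | hw
  · rw [ENNReal.top_rpow_of_pos hp, eq_top_iff]
    refine ENNReal.le_of_forall_nnreal_lt fun r hr => ?_
    have := hfin ((r:ℝ) ^ (1/p)) (by positivity)
    rw [ENNReal.ofReal_rpow_of_nonneg (by positivity) hp.le, ← Real.rpow_mul (by positivity),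
      one_div_mul_cancel hp.ne', Real.rpow_one, ENNReal.ofReal_coe_nnreal] at this
    rw [← this]
    refine lintegral_mono fun t => ?_
    refine indicator_le_indicator_of_subset ?_ (fun _ => zero_le) t
    intro t ht
    rw [mem_ofPred_eq] at ht ⊢
    exact lt_of_lt_of_le ht le_top
  · rw [← ENNReal.ofReal_toReal hw]
    exact hfin _ ENNReal.toReal_nonneg

lemma lc {α : Type*} [MeasurableSpace α] (ν : Measure α) [SFinite ν] {w : α → ℝ≥0∞}
    (hw : Measurable w) {p : ℝ} (hp : 0 < p) :
    ∫⁻ a, w a ^ p ∂ν =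
      ∫⁻ t in Ioi (0:ℝ), ν {a | ENNReal.ofReal t < w a} * ENNReal.ofReal (p * t ^ (p-1)) := by
  simp_rw [← lc_pt hp]
  have hmS : MeasurableSet {q : α × ℝ | ENNReal.ofReal q.2 < w q.1} :=
    measurableSet_lt (by fun_prop) (by fun_prop)
  rw [lintegral_lintegral_swap]
  · refine lintegral_congr fun t => ?_
    have : (fun a => ({t : ℝ | ENNReal.ofReal t < w a}).indicator
      (fun t => ENNReal.ofReal (p * t ^ (p-1))) t) =
      ({a | ENNReal.ofReal t < w a}).indicator (fun _ => ENNReal.ofReal (p * t ^ (p-1))) := by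
      ext a; simp [indicator]
    rw [this, lintegral_indicator (measurableSet_lt measurable_const hw), lintegral_const,
      Measure.restrict_apply MeasurableSet.univ, univ_inter, mul_comm]
  · have : (Function.uncurry fun a t => ({t : ℝ | ENNReal.ofReal t < w a}).indicator
      (fun t => ENNReal.ofReal (p * t ^ (p-1))) t) =
      ({q : α × ℝ | ENNReal.ofReal q.2 < w q.1}).indicator
        (fun q => ENNReal.ofReal (p * q.2 ^ (p-1))) := by
      ext ⟨a, t⟩; simp [indicator, Function.uncurry]
    rw [this]
    exact (Measurable.indicator (by fun_prop) hmS).aemeasurable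

end GT


namespace GT

section HL
variable {E : Type*} [NormedAddCommGroup E] [NormedSpace ℝ E] [MeasurableSpace E] [BorelSpace E]
  [FiniteDimensional ℝ E] (μ : Measure E) [μ.IsAddHaarMeasure]

/-- average over the ball of radius `r` -/
noncomputable def av (r : ℝ) (u : E → ℝ≥0∞) (x : E) : ℝ≥0∞ :=
  (μ (ball (0:E) r))⁻¹ * ∫⁻ y in ball x r, u y ∂μ

/-- dyadic radius Hardy-Littlewood maximal function -/
noncomputable def mx (u : E → ℝ≥0∞) (x : E) : ℝ≥0∞ := ⨆ k : ℤ, av μ ((2:ℝ) ^ k) u x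

lemma two_zpos (k : ℤ) : (0:ℝ) < (2:ℝ) ^ k := by positivity

lemma ball0_ne_zero {r : ℝ} (hr : 0 < r) : μ (ball (0:E) r) ≠ 0 := (measure_ball_pos μ 0 hr).ne'
lemma ball0_ne_top {r : ℝ} : μ (ball (0:E) r) ≠ ⊤ := measure_ball_lt_top.ne

lemma meas_ball (x : E) (r : ℝ) : μ (ball x r) = μ (ball (0:E) r) :=
  Measure.addHaar_ball_center μ x r

lemma av_mono (r : ℝ) {u v : E → ℝ≥0∞} (h : ∀ y, u y ≤ v y) (x : E) : av μ r u x ≤ av μ r v x := by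
  unfold av; gcongr; exact h _

lemma mx_mono {u v : E → ℝ≥0∞} (h : ∀ y, u y ≤ v y) (x : E) : mx μ u x ≤ mx μ v x :=
  iSup_mono fun k => av_mono μ _ h x

lemma mx_add_le {u v : E → ℝ≥0∞} (hu : Measurable u) (x : E) :
    mx μ (fun y => u y + v y) x ≤ mx μ u x + mx μ v x := by
  refine iSup_le fun k => ?_
  unfold av
  rw [lintegral_add_left hu, mul_add]
  exact add_le_add (le_iSup (fun k : ℤ => av μ ((2:ℝ) ^ k) u x) k)
    (le_iSup (fun k : ℤ => av μ ((2:ℝ) ^ k) v x) k)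

lemma av_const_le {r : ℝ} (c : ℝ≥0∞) (x : E) : av μ r (fun _ => c) x ≤ c := by
  unfold av
  rw [setLIntegral_const, meas_ball μ x r]
  calc (μ (ball (0:E) r))⁻¹ * (c * μ (ball (0:E) r)) = c * ((μ (ball (0:E) r))⁻¹ * μ (ball (0:E) r)) := by ring
    _ ≤ c * 1 := by gcongr; exact ENNReal.inv_mul_le_one _
    _ = c := mul_one _

lemma mx_const_le (c : ℝ≥0∞) (x : E) : mx μ (fun _ => c) x ≤ c :=
  iSup_le fun _ => av_const_le μ c x

/-- joint measurability of averages with a parameter -/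
lemma measurable_av {P : Type*} [MeasurableSpace P] {u : P → E → ℝ≥0∞}
    (hu : Measurable (Function.uncurry u)) (r : ℝ) :
    Measurable (fun q : P × E => av μ r (u q.1) q.2) := by
  unfold av
  refine Measurable.const_mul ?_ _
  have : (fun q : P × E => ∫⁻ y in ball q.2 r, u q.1 y ∂μ) =
      fun q : P × E => ∫⁻ y, ({w : (P × E) × E | dist w.2 w.1.2 < r}).indicator
        (fun w => u w.1.1 w.2) (q, y) ∂μ := by
    ext q
    rw [← lintegral_indicator measurableSet_ball]
    refine lintegral_congr fun y => ?_
    simp [indicator, mem_ball]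
  rw [this]
  refine Measurable.lintegral_prod_right' (f := ({w : (P × E) × E | dist w.2 w.1.2 < r}).indicator
        (fun w => u w.1.1 w.2)) ?_
  refine Measurable.indicator ?_ ?_
  · exact hu.comp (by fun_prop : Measurable fun w : (P × E) × E => (w.1.1, w.2))
  · exact measurableSet_lt (by fun_prop) (by fun_prop)

lemma measurable_mx_param {P : Type*} [MeasurableSpace P] {u : P → E → ℝ≥0∞}
    (hu : Measurable (Function.uncurry u)) :
    Measurable (fun q : P × E => mx μ (u q.1) q.2) :=
  Measurable.iSup fun _ => measurable_av μ hu _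

lemma measurable_mx {u : E → ℝ≥0∞} (hu : Measurable u) : Measurable (mx μ u) := by
  have h0 : Measurable (Function.uncurry (fun _ : Unit => u)) := by
    have : Function.uncurry (fun _ : Unit => u) = u ∘ Prod.snd := by ext ⟨a, b⟩; rfl
    rw [this]; exact hu.comp measurable_snd
  have h1 := measurable_mx_param μ h0
  have h2 : Measurable (fun x : E => (((), x) : Unit × E)) := measurable_prodMk_left
  have h3 := h1.comp h2
  simpa only [Function.comp_def] using h3

lemma le_of_lt_av {r : ℝ} (hr : 0 < r) {u : E → ℝ≥0∞} {x : E} {l : ℝ≥0∞} (h : l ≤ av μ r u x) :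
    l * μ (ball (0:E) r) ≤ ∫⁻ y in ball x r, u y ∂μ := by
  calc l * μ (ball (0:E) r) ≤ av μ r u x * μ (ball (0:E) r) := by gcongr
    _ = (μ (ball (0:E) r))⁻¹ * μ (ball (0:E) r) * ∫⁻ y in ball x r, u y ∂μ := by unfold av; ring
    _ = _ := by rw [ENNReal.inv_mul_cancel (ball0_ne_zero μ hr) (ball0_ne_top μ), one_mul]

/-- weak type (1,1) -/
lemma weak_type (u : E → ℝ≥0∞) (l : ℝ≥0∞) :
    l * μ {x | l < mx μ u x} ≤ 3 ^ (Module.finrank ℝ E) * ∫⁻ y, u y ∂μ := by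
  set F : ℕ → Set E := fun K => {x | ∃ k : ℤ, k ≤ K ∧ l < av μ ((2:ℝ) ^ k) u x} with hF
  have hFmono : Monotone F := by
    intro K L hKL x hx
    simp only [hF, mem_ofPred_eq] at hx ⊢
    obtain ⟨k, hk, h⟩ := hx
    exact ⟨k, hk.trans (by exact_mod_cast hKL), h⟩
  have hU : {x | l < mx μ u x} = ⋃ K, F K := by
    ext x
    simp only [hF, mem_ofPred_eq, mem_iUnion, mx, lt_iSup_iff]
    constructor
    · rintro ⟨k, hk⟩
      exact ⟨k.toNat, k, Int.self_le_toNat k, hk⟩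
    · rintro ⟨K, k, _, h⟩
      exact ⟨k, h⟩
  rw [hU, hFmono.measure_iUnion, ENNReal.mul_iSup]
  refine iSup_le fun K => ?_
  have hch : ∀ x : E, ∃ k : ℤ, x ∈ F K → (k ≤ K ∧ l < av μ ((2:ℝ) ^ k) u x) := by
    intro x
    by_cases hx : x ∈ F K
    · obtain ⟨k, hk⟩ := hx
      exact ⟨k, fun _ => hk⟩
    · exact ⟨0, fun h => absurd h hx⟩
  choose k hk using hch
  obtain ⟨v, hvF, hdisj, hcov⟩ := Vitali.exists_disjoint_subfamily_covering_enlargement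
    (fun x : E => ball x ((2:ℝ) ^ (k x))) (F K) (fun x => (2:ℝ) ^ (k x)) 2 (by norm_num)
    (fun x _ => (two_zpos _).le) ((2:ℝ) ^ (K:ℤ))
    (fun x hx => zpow_le_zpow_right₀ (by norm_num) (hk x hx).1)
    (fun x hx => ⟨x, mem_ball_self (two_zpos _)⟩)
  have hvc : v.Countable := hdisj.countable_of_isOpen (fun _ _ => isOpen_ball)
    (fun x _ => ⟨x, mem_ball_self (two_zpos _)⟩)
  have hsub : F K ⊆ ⋃ b ∈ v, ball b (3 * (2:ℝ) ^ (k b)) := by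
    intro x hx
    obtain ⟨b, hb, ⟨y, hy1, hy2⟩, hle⟩ := hcov x hx
    refine mem_iUnion₂.2 ⟨b, hb, ?_⟩
    rw [mem_ball] at hy1 hy2 ⊢
    have := dist_triangle_left x b y
    linarith
  have : Countable v := hvc.to_subtype
  calc l * μ (F K) ≤ l * ∑' b : v, μ (ball (b:E) (3 * (2:ℝ) ^ (k b))) := by
        gcongr
        exact (measure_mono hsub).trans (measure_biUnion_le μ hvc _)
    _ = ∑' b : v, 3 ^ (Module.finrank ℝ E) * (l * μ (ball (0:E) ((2:ℝ) ^ (k b)))) := by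
        rw [← ENNReal.tsum_mul_left]
        congr 1; ext b
        rw [Measure.addHaar_ball_mul_of_pos μ _ (by norm_num : (0:ℝ) < 3), ENNReal.ofReal_pow (by norm_num)]
        simp only [ENNReal.ofReal_ofNat]
        ring
    _ ≤ ∑' b : v, 3 ^ (Module.finrank ℝ E) * ∫⁻ y in ball (b:E) ((2:ℝ) ^ (k b)), u y ∂μ := by
        refine ENNReal.tsum_le_tsum fun b => ?_
        gcongr
        exact le_of_lt_av μ (two_zpos _) (hk b (hvF b.2)).2.le
    _ = 3 ^ (Module.finrank ℝ E) * ∫⁻ y in ⋃ b ∈ v, ball b ((2:ℝ) ^ (k b)), u y ∂μ := by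
        rw [ENNReal.tsum_mul_left, lintegral_biUnion hvc (fun _ _ => measurableSet_ball) hdisj]
    _ ≤ _ := by
        gcongr
        exact Measure.restrict_le_self

/-- strong type (p,p) with explicit constant -/
lemma strong_type {u : E → ℝ≥0∞} (hu : Measurable u) {p : ℝ} (hp : 1 < p) :
    ∫⁻ x, mx μ u x ^ p ∂μ ≤
      (3 ^ (Module.finrank ℝ E) * ENNReal.ofReal (2 ^ p * p / (p-1))) * ∫⁻ x, u x ^ p ∂μ := by
  set D : ℝ≥0∞ := 3 ^ (Module.finrank ℝ E) with hD
  rw [lc μ (measurable_mx μ hu) (by linarith)]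
  set ν := μ.withDensity u with hν
  have hms : ∀ t : ℝ, MeasurableSet {x | ENNReal.ofReal t < 2 * u x} := fun t =>
    measurableSet_lt measurable_const (hu.const_mul 2)
  have key : ∀ t : ℝ, 0 < t → μ {x | ENNReal.ofReal t < mx μ u x} * ENNReal.ofReal t
      ≤ 2 * D * ν {x | ENNReal.ofReal t < 2 * u x} := by
    intro t ht
    set S := {x | ENNReal.ofReal t < 2 * u x} with hS
    have hpt : ∀ y, u y ≤ S.indicator u y + ENNReal.ofReal (t/2) := by
      intro y
      by_cases hy : y ∈ S
      · rw [indicator_of_mem hy]; exact le_self_add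
      · rw [indicator_of_notMem hy, zero_add]
        rw [hS, mem_ofPred_eq, not_lt] at hy
        rw [show t = 2 * (t/2) by ring, ENNReal.ofReal_mul (by norm_num)] at hy
        simp only [ENNReal.ofReal_ofNat] at hy
        exact (ENNReal.mul_le_mul_iff_right (by norm_num) (by norm_num)).1 hy
    have hsub : {x | ENNReal.ofReal t < mx μ u x} ⊆
        {x | ENNReal.ofReal (t/2) < mx μ (S.indicator u) x} := by
      intro x hx
      rw [mem_ofPred_eq] at hx ⊢
      have h1 : mx μ u x ≤ mx μ (S.indicator u) x + ENNReal.ofReal (t/2) :=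
        (mx_mono μ hpt x).trans ((mx_add_le μ (hu.indicator (hms t)) x).trans
          (by gcongr; exact mx_const_le μ _ x))
      by_contra hcon
      rw [not_lt] at hcon
      have h2 := hx.trans_le (h1.trans (add_le_add_left hcon _))
      rw [← ENNReal.ofReal_add (by linarith) (by linarith), add_halves] at h2
      exact lt_irrefl _ h2
    have hw := weak_type μ (S.indicator u) (ENNReal.ofReal (t/2))
    rw [lintegral_indicator (hms t)] at hw
    rw [hν, withDensity_apply _ (hms t)]
    calc μ {x | ENNReal.ofReal t < mx μ u x} * ENNReal.ofReal t
        ≤ μ {x | ENNReal.ofReal (t/2) < mx μ (S.indicator u) x} * ENNReal.ofReal t := by gcongr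
      _ = 2 * (ENNReal.ofReal (t/2) * μ {x | ENNReal.ofReal (t/2) < mx μ (S.indicator u) x}) := by
          conv_lhs => rw [show t = 2 * (t/2) by ring, ENNReal.ofReal_mul (by norm_num)]
          simp only [ENNReal.ofReal_ofNat, mul_div_cancel_left₀ (t/2) (two_ne_zero)]
          ring
      _ ≤ 2 * (D * ∫⁻ y in S, u y ∂μ) := by gcongr
      _ = _ := by ring
  have hpp : 0 < p - 1 := by linarith
  calc ∫⁻ t in Ioi (0:ℝ), μ {a | ENNReal.ofReal t < mx μ u a} * ENNReal.ofReal (p * t ^ (p-1))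
      ≤ ∫⁻ t in Ioi (0:ℝ), (2 * D * ENNReal.ofReal (p / (p-1))) *
          (ν {x | ENNReal.ofReal t < 2 * u x} * ENNReal.ofReal ((p-1) * t ^ (p-1-1))) := by
        refine setLIntegral_mono_ae' measurableSet_Ioi (Eventually.of_forall fun t ht => ?_)
        rw [mem_Ioi] at ht
        have e1 : p * t ^ (p-1) = t * ((p / (p-1)) * ((p-1) * t ^ (p-1-1))) := by
          have : t ^ (p-1) = t ^ (p-1-1) * t := by
            rw [← Real.rpow_add_one ht.ne']; ring_nf
          rw [this]
          field_simp
        have hA : 0 ≤ (p / (p-1)) := by positivity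
        rw [e1, ENNReal.ofReal_mul ht.le, ENNReal.ofReal_mul hA, ← mul_assoc (μ _)]
        calc _ ≤ (2 * D * ν {x | ENNReal.ofReal t < 2 * u x}) *
              (ENNReal.ofReal (p / (p-1)) * ENNReal.ofReal ((p-1) * t ^ (p-1-1))) := by
              exact mul_le_mul_left (key t ht) _
          _ = _ := by ring
    _ = (2 * D * ENNReal.ofReal (p / (p-1))) * ∫⁻ x, (2 * u x) ^ (p-1) ∂ν := by
        rw [lintegral_const_mul' _ _ (by
          rw [hD]; refine ENNReal.mul_ne_top (ENNReal.mul_ne_top (by norm_num) (by simp)) (by simp)),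
          lc ν (hu.const_mul 2) hpp]
    _ = _ := by
        rw [hν, lintegral_withDensity_eq_lintegral_mul _ hu (by fun_prop)]
        have : ∀ x, (u * fun x => (2 * u x) ^ (p-1)) x = 2 ^ (p-1) * u x ^ p := by
          intro x
          simp only [Pi.mul_apply]
          rw [ENNReal.mul_rpow_of_nonneg _ _ hpp.le]
          conv_rhs => rw [show p = 1 + (p-1) by ring,
            ENNReal.rpow_add_of_nonneg _ _ zero_le_one hpp.le, ENNReal.rpow_one]
          ring_nf
        simp_rw [this]
        rw [lintegral_const_mul _ (by fun_prop)]
        have e2 : ENNReal.ofReal (2 ^ p * p / (p-1)) = 2 * 2 ^ (p-1) * ENNReal.ofReal (p/(p-1)) := by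
          rw [show (2:ℝ) ^ p * p / (p-1) = 2 * 2 ^ (p-1) * (p/(p-1)) by
            rw [Real.rpow_sub_one (by norm_num)]; ring]
          rw [ENNReal.ofReal_mul (by positivity), ENNReal.ofReal_mul (by norm_num),
            ← ENNReal.ofReal_rpow_of_pos (by norm_num)]
          simp
        rw [e2]; ring
end HL

end GT


namespace GT

section FR
variable {E : Type*} [NormedAddCommGroup E] [NormedSpace ℝ E] [MeasurableSpace E] [BorelSpace E]
  [FiniteDimensional ℝ E] (μ : Measure E) [μ.IsAddHaarMeasure]

/-- fractional maximal function -/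
noncomputable def fmx (σ : ℝ) (u : E → ℝ≥0∞) (x : E) : ℝ≥0∞ :=
  ⨆ k : ℤ, ENNReal.ofReal (((2:ℝ) ^ k) ^ σ) * av μ ((2:ℝ) ^ k) u x

lemma measurable_fmx_param (σ : ℝ) {P : Type*} [MeasurableSpace P] {u : P → E → ℝ≥0∞}
    (hu : Measurable (Function.uncurry u)) :
    Measurable (fun q : P × E => fmx μ σ (u q.1) q.2) :=
  Measurable.iSup fun _ => (measurable_av μ hu _).const_mul _

lemma av_le_norm {r : ℝ} (hr : 0 < r) {u : E → ℝ≥0∞} (hu : Measurable u) {q : ℝ} (hq : 1 < q) (x : E) :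
    av μ r u x ≤ (μ (ball (0:E) r)) ^ (-(1/q)) * (∫⁻ y, u y ^ q ∂μ) ^ (1/q) := by
  have hc : q.HolderConjugate (q.conjExponent) := Real.HolderConjugate.conjExponent hq
  have h1 := ENNReal.lintegral_mul_le_Lp_mul_Lq (μ.restrict (ball x r)) hc (f := u) (g := fun _ => 1)
    hu.aemeasurable aemeasurable_const
  simp only [Pi.mul_apply, mul_one, ENNReal.one_rpow, lintegral_const, one_mul,
    Measure.restrict_apply MeasurableSet.univ, univ_inter] at h1
  rw [meas_ball μ x r] at h1
  set m := μ (ball (0:E) r)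
  have hm0 : m ≠ 0 := ball0_ne_zero μ hr
  have hmt : m ≠ ⊤ := ball0_ne_top μ
  have hexp : (-1:ℝ) + 1 / q.conjExponent = -(1/q) := by
    have := hc.inv_add_inv_eq_one
    rw [one_div, one_div]; linarith
  calc av μ r u x ≤ m⁻¹ * ((∫⁻ y in ball x r, u y ^ q ∂μ) ^ (1/q) * m ^ (1/q.conjExponent)) := by
        unfold av; exact mul_le_mul_right h1 _
    _ = m ^ (-(1/q)) * (∫⁻ y in ball x r, u y ^ q ∂μ) ^ (1/q) := by
        rw [← hexp, ENNReal.rpow_add _ _ hm0 hmt, ENNReal.rpow_neg_one]; ring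
    _ ≤ _ := by
        have : 0 ≤ 1/q := by positivity
        gcongr
        exact Measure.restrict_le_self

lemma fmx_le {u : E → ℝ≥0∞} (hu : Measurable u) {q₁ q σ : ℝ} (hq₁ : 1 < q₁) (hq : 0 < q) (hσ : 0 ≤ σ)
    (hd : 0 < Module.finrank ℝ E) (h : 1/q₁ - σ / (Module.finrank ℝ E : ℝ) = 1/q) (x : E) :
    fmx μ σ u x ≤ (μ (ball (0:E) 1)) ^ (-((1 - q₁/q)/q₁)) *
      ((∫⁻ y, u y ^ q₁ ∂μ) ^ (1/q₁)) ^ (1 - q₁/q) * mx μ u x ^ (q₁/q) := by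
  set d := Module.finrank ℝ E with hdd
  have hdR : (0:ℝ) < d := by exact_mod_cast hd
  have hq1p : 0 < q₁ := by linarith
  have hη : 0 ≤ 1 - q₁/q := by
    have : q₁/q = 1 - q₁ * σ / d := by
      rw [div_eq_mul_one_div, ← h]; field_simp
    rw [this]; have : 0 ≤ q₁ * σ / d := by positivity
    linarith
  have hησ : (d:ℝ) * ((1 - q₁/q)/q₁) = σ := by
    have : q₁/q = 1 - q₁ * σ / d := by
      rw [div_eq_mul_one_div, ← h]; field_simp
    rw [this]; field_simp; ring
  have hr : 0 ≤ q₁/q := by positivity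
  refine iSup_le fun k => ?_
  set ρ : ℝ := (2:ℝ)^k with hρ
  have hρ0 : 0 < ρ := two_zpos k
  set R := ENNReal.ofReal ρ with hR
  have hR0 : R ≠ 0 := by simp [hR, hρ0]
  have hRt : R ≠ ⊤ := by simp [hR]
  set N := (∫⁻ y, u y ^ q₁ ∂μ) ^ (1/q₁)
  set m := μ (ball (0:E) 1)
  have hm0 : m ≠ 0 := ball0_ne_zero μ one_pos
  have hmt : m ≠ ⊤ := ball0_ne_top μ
  set η := 1 - q₁/q with hηdef
  have hball : μ (ball (0:E) ρ) = R ^ d * m := by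
    have := Measure.addHaar_ball_mul_of_pos μ (0:E) hρ0 1
    rw [mul_one] at this
    rw [this, ENNReal.ofReal_pow hρ0.le]
  have h1 := av_le_norm μ hρ0 hu hq₁ x
  have h2 : av μ ρ u x ≤ mx μ u x := le_iSup (fun k : ℤ => av μ ((2:ℝ)^k) u x) k
  have hsplit : av μ ρ u x = av μ ρ u x ^ η * av μ ρ u x ^ (q₁/q) := by
    rw [← ENNReal.rpow_add_of_nonneg _ _ hη hr, hηdef]; simp
  have hX : ENNReal.ofReal (ρ ^ σ) * (μ (ball (0:E) ρ) ^ (-(1/q₁))) ^ η = m ^ (-(η/q₁)) := by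
    rw [← ENNReal.rpow_mul, hball, show -(1/q₁) * η = -(η/q₁) by ring,
      ENNReal.mul_rpow_of_ne_top (by simp [hRt]) hmt, ← ENNReal.rpow_natCast, ← ENNReal.rpow_mul,
      ← ENNReal.ofReal_rpow_of_pos hρ0, ← mul_assoc, ← ENNReal.rpow_add _ _ hR0 hRt]
    rw [show σ + (d:ℝ) * -(η/q₁) = 0 by rw [mul_neg, hησ]; ring, ENNReal.rpow_zero, one_mul]
  calc ENNReal.ofReal (ρ ^ σ) * av μ ρ u x
      = ENNReal.ofReal (ρ ^ σ) * (av μ ρ u x ^ η * av μ ρ u x ^ (q₁/q)) := by rw [← hsplit]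
    _ ≤ ENNReal.ofReal (ρ ^ σ) * ((μ (ball (0:E) ρ) ^ (-(1/q₁)) * N) ^ η * mx μ u x ^ (q₁/q)) := by
        gcongr
    _ = (ENNReal.ofReal (ρ ^ σ) * (μ (ball (0:E) ρ) ^ (-(1/q₁))) ^ η) * N ^ η * mx μ u x ^ (q₁/q) := by
        rw [ENNReal.mul_rpow_of_nonneg _ _ hη]; ring
    _ = _ := by rw [hX]

lemma fmx_bound {q₁ q σ : ℝ} (hq₁ : 1 < q₁) (hq : 0 < q) (hσ : 0 ≤ σ)
    (hd : 0 < Module.finrank ℝ E) (h : 1/q₁ - σ / (Module.finrank ℝ E : ℝ) = 1/q) :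
    ∃ C : ℝ≥0∞, C ≠ ⊤ ∧ ∀ u : E → ℝ≥0∞, Measurable u →
      ∫⁻ x, fmx μ σ u x ^ q ∂μ ≤ C * (∫⁻ x, u x ^ q₁ ∂μ) ^ (q/q₁) := by
  have hq1p : 0 < q₁ := by linarith
  have hqq : 0 ≤ q - q₁ := by
    have hdR : (0:ℝ) < Module.finrank ℝ E := by exact_mod_cast hd
    have h1 : 1/q ≤ 1/q₁ := by
      rw [← h]; have : 0 ≤ σ / (Module.finrank ℝ E : ℝ) := by positivity
      linarith
    have := (one_div_le_one_div hq hq1p).1 h1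
    linarith
  set m := μ (ball (0:E) 1)
  have hm0 : m ≠ 0 := ball0_ne_zero μ one_pos
  have hmt : m ≠ ⊤ := ball0_ne_top μ
  set c := m ^ (-((1 - q₁/q)/q₁))
  have hct : c ≠ ⊤ := by
    simp only [c, ne_eq, ENNReal.rpow_eq_top_iff, hm0, hmt, false_and, or_self, not_false_eq_true]
  refine ⟨c ^ q * (3 ^ (Module.finrank ℝ E) * ENNReal.ofReal (2 ^ q₁ * q₁ / (q₁-1))),
    ENNReal.mul_ne_top (ENNReal.rpow_ne_top_of_nonneg hq.le hct)
      (ENNReal.mul_ne_top (by simp) (by simp)), fun u hu => ?_⟩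
  set I := ∫⁻ x, u x ^ q₁ ∂μ
  calc ∫⁻ x, fmx μ σ u x ^ q ∂μ
      ≤ ∫⁻ x, (c ^ q * I ^ ((q - q₁)/q₁)) * mx μ u x ^ q₁ ∂μ := by
        refine lintegral_mono fun x => ?_
        refine (ENNReal.rpow_le_rpow (fmx_le μ hu hq₁ hq hσ hd h x) hq.le).trans (le_of_eq ?_)
        rw [ENNReal.mul_rpow_of_nonneg _ _ hq.le, ENNReal.mul_rpow_of_nonneg _ _ hq.le,
          ← ENNReal.rpow_mul (mx μ u x), ← ENNReal.rpow_mul (_ ^ (1/q₁)), ← ENNReal.rpow_mul I]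
        have e1 : 1/q₁ * ((1 - q₁/q) * q) = (q - q₁)/q₁ := by field_simp
        have e2 : q₁/q * q = q₁ := by field_simp
        rw [e1, e2]
    _ = (c ^ q * I ^ ((q - q₁)/q₁)) * ∫⁻ x, mx μ u x ^ q₁ ∂μ :=
        lintegral_const_mul _ ((measurable_mx μ hu).pow_const _)
    _ ≤ (c ^ q * I ^ ((q - q₁)/q₁)) *
        ((3 ^ (Module.finrank ℝ E) * ENNReal.ofReal (2 ^ q₁ * q₁ / (q₁-1))) * I) := by
        gcongr; exact strong_type μ hu hq₁
    _ = _ := by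
        have : I ^ (q/q₁) = I ^ ((q - q₁)/q₁) * I := by
          conv_rhs => rw [← ENNReal.rpow_one I, ← ENNReal.rpow_mul, one_mul,
            ← ENNReal.rpow_add_of_nonneg _ _ (by positivity) zero_le_one]
          congr 1; field_simp; ring
        rw [this]; ring
end FR

lemma minkowski {T X : Type*} [MeasurableSpace T] [MeasurableSpace X] (ν : Measure T) (μ : Measure X)
    [SFinite ν] [SigmaFinite μ] {K : T → X → ℝ≥0∞} (hK : Measurable (Function.uncurry K))
    {r : ℝ} (hr : 1 ≤ r) :
    ∫⁻ x, (∫⁻ t, K t x ∂ν) ^ r ∂μ ≤ (∫⁻ t, (∫⁻ x, K t x ^ r ∂μ) ^ (1/r) ∂ν) ^ r := by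
  have hKx : ∀ t, Measurable (K t) := fun t => hK.comp measurable_prodMk_left
  have hKt : ∀ x, Measurable (fun t => K t x) := fun x => hK.comp measurable_prodMk_right
  rcases eq_or_lt_of_le hr with rfl | hr1
  · simp only [ENNReal.rpow_one, div_one]
    rw [lintegral_lintegral_swap]
    exact (hK.comp measurable_swap).aemeasurable
  have hr0 : 0 < r := by linarith
  set Φ : X → ℝ≥0∞ := fun x => ∫⁻ t, K t x ∂ν with hΦ
  have hΦm : Measurable Φ := Measurable.lintegral_prod_left' hK
  set W := ∫⁻ t, (∫⁻ x, K t x ^ r ∂μ) ^ (1/r) ∂ν with hW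
  set φ : ℕ → X → ℝ≥0∞ := fun m => (spanningSets μ m).indicator (fun x => min (Φ x) m) with hφ
  have hφm : ∀ m, Measurable (φ m) := fun m =>
    (hΦm.min measurable_const).indicator (measurableSet_spanningSets μ m)
  have hφle : ∀ m x, φ m x ≤ Φ x := fun m x => by
    simp only [hφ]
    exact (indicator_le_self' (fun _ _ => zero_le) x).trans (min_le_left _ _)
  have main : ∀ m, ∫⁻ x, φ m x ^ r ∂μ ≤ W ^ r := by
    intro m
    set I := ∫⁻ x, φ m x ^ r ∂μ with hI
    have hIt : I ≠ ⊤ := by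
      refine ne_of_lt ?_
      calc I ≤ ∫⁻ x, (spanningSets μ m).indicator (fun _ => (m:ℝ≥0∞) ^ r) x ∂μ := by
            refine lintegral_mono fun x => ?_
            by_cases hx : x ∈ spanningSets μ m
            · simp only [hφ, indicator_of_mem hx]
              exact ENNReal.rpow_le_rpow (min_le_right _ _) hr0.le
            · simp only [hφ, indicator_of_notMem hx, ENNReal.zero_rpow_of_pos hr0, le_refl]
        _ = (m:ℝ≥0∞) ^ r * μ (spanningSets μ m) := by
            rw [lintegral_indicator (measurableSet_spanningSets μ m), setLIntegral_const]
        _ < ⊤ := ENNReal.mul_lt_top (ENNReal.rpow_lt_top_of_nonneg hr0.le (by simp))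
            (measure_spanningSets_lt_top μ m)
    have hc : r.HolderConjugate (r.conjExponent) := Real.HolderConjugate.conjExponent hr1
    have hrr : 0 ≤ r - 1 := by linarith
    have hIle : I ≤ W * I ^ (1 / r.conjExponent) := by
      calc I ≤ ∫⁻ x, ∫⁻ t, K t x * φ m x ^ (r-1) ∂ν ∂μ := by
            refine lintegral_mono fun x => ?_
            rw [lintegral_mul_const _ (hKt x)]
            calc φ m x ^ r = φ m x * φ m x ^ (r-1) := by
                  conv_lhs => rw [show r = 1 + (r-1) by ring,
                    ENNReal.rpow_add_of_nonneg _ _ zero_le_one hrr, ENNReal.rpow_one]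
              _ ≤ _ := by gcongr; exact hφle m x
        _ = ∫⁻ t, ∫⁻ x, K t x * φ m x ^ (r-1) ∂μ ∂ν := by
            rw [lintegral_lintegral_swap]
            refine Measurable.aemeasurable ?_
            exact (hK.comp measurable_swap).mul (((hφm m).comp measurable_fst).pow_const _)
        _ ≤ ∫⁻ t, (∫⁻ x, K t x ^ r ∂μ) ^ (1/r) * I ^ (1 / r.conjExponent) ∂ν := by
            refine lintegral_mono fun t => ?_
            have := ENNReal.lintegral_mul_le_Lp_mul_Lq μ hc (f := K t) (g := fun x => φ m x ^ (r-1))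
              (hKx t).aemeasurable ((hφm m).pow_const _).aemeasurable
            simp only [Pi.mul_apply] at this
            refine this.trans (le_of_eq ?_)
            congr 2
            refine lintegral_congr fun x => ?_
            rw [← ENNReal.rpow_mul]
            congr 1
            rw [Real.conjExponent]; field_simp
        _ = W * I ^ (1 / r.conjExponent) := by
            rw [lintegral_mul_const']
            refine ENNReal.rpow_ne_top_of_nonneg ?_ hIt
            exact one_div_nonneg.2 hc.symm.nonneg
    rcases eq_or_ne I 0 with h0 | h0
    · rw [h0]; exact zero_le
    have hJ0 : I ^ (1 / r.conjExponent) ≠ 0 := by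
      simp [ENNReal.rpow_eq_zero_iff, h0, hIt]
    have hJt : I ^ (1 / r.conjExponent) ≠ ⊤ :=
      ENNReal.rpow_ne_top_of_nonneg (one_div_nonneg.2 hc.symm.nonneg) hIt
    have h3 : I ^ (1/r) ≤ W := by
      have e : I = I ^ (1/r) * I ^ (1 / r.conjExponent) := by
        rw [← ENNReal.rpow_add _ _ h0 hIt]
        have := hc.inv_add_inv_eq_one
        rw [one_div, one_div, this, ENNReal.rpow_one]
      rw [e] at hIle
      have h4 : I ^ (1/r) * I ^ (1 / r.conjExponent) ≤ W * I ^ (1 / r.conjExponent) := by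
        rw [← e] at hIle; exact e ▸ hIle
      exact (ENNReal.mul_le_mul_iff_left hJ0 hJt).1 h4
    calc I = (I ^ (1/r)) ^ r := by rw [← ENNReal.rpow_mul, one_div_mul_cancel hr0.ne', ENNReal.rpow_one]
      _ ≤ W ^ r := by gcongr
  have hlim : ∀ x, Tendsto (fun m => φ m x ^ r) atTop (𝓝 (Φ x ^ r)) := by
    intro x
    refine (ENNReal.continuous_rpow_const.tendsto _).comp ?_
    have h1 : Tendsto (fun m : ℕ => min (Φ x) (m:ℝ≥0∞)) atTop (𝓝 (min (Φ x) ⊤)) :=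
      tendsto_const_nhds.min ENNReal.tendsto_nat_nhds_top
    rw [min_eq_left le_top] at h1
    refine h1.congr' ?_
    filter_upwards [eventually_ge_atTop (spanningSetsIndex μ x)] with m hm
    have : x ∈ spanningSets μ m :=
      monotone_spanningSets μ hm (mem_spanningSetsIndex μ x)
    simp only [hφ, indicator_of_mem this]
  calc ∫⁻ x, Φ x ^ r ∂μ = ∫⁻ x, liminf (fun m => φ m x ^ r) atTop ∂μ :=
        lintegral_congr fun x => (hlim x).liminf_eq.symm
    _ ≤ liminf (fun m => ∫⁻ x, φ m x ^ r ∂μ) atTop := lintegral_liminf_le fun m => (hφm m).pow_const _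
    _ ≤ W ^ r := by
        refine liminf_le_of_le ?_ ?_
        · isBoundedDefault
        · intro b hb
          obtain ⟨m, hm⟩ := hb.exists
          exact hm.trans (main m)

end GT


namespace GT

section PR
variable {n : ℕ}

lemma fmx_zero {E : Type*} [NormedAddCommGroup E] [MeasurableSpace E] (μ : Measure E)
    (u : E → ℝ≥0∞) (x : E) : fmx μ 0 u x = mx μ u x := by
  simp [fmx, mx]

lemma av_const_mul {E : Type*} [NormedAddCommGroup E] [MeasurableSpace E] (μ : Measure E) (r : ℝ)
    {c : ℝ≥0∞} (hc : c ≠ ⊤) (u : E → ℝ≥0∞) (x : E) :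
    av μ r (fun y => c * u y) x = c * av μ r u x := by
  unfold av
  rw [lintegral_const_mul' _ _ hc]; ring

/-- iterated fractional maximal function -/
noncomputable def FM (a b : ℝ) (u : Pt n → ℝ≥0∞) (z : Pt n) : ℝ≥0∞ :=
  fmx volume a (fun s : ℝ => fmx volume b (fun y : Spc n => u (s, y)) z.2) z.1

/-- average over a set of space-time -/
noncomputable def cavg (S : Set (Pt n)) (u : Pt n → ℝ≥0∞) : ℝ≥0∞ :=
  (volume S)⁻¹ * ∫⁻ z in S, u z

/-- tail functional in `ℝ≥0∞` -/
noncomputable def tailE (γ : ℝ) (u : Pt n → ℝ≥0∞) (t : ℝ) (x : Spc n) (r : ℝ) : ℝ≥0∞ :=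
  ∑' j : ℕ, (2⁻¹ : ℝ≥0∞) ^ (j+1) * cavg (cylinder t x ((4:ℝ)^j * r^2) (γ * r)) u

lemma measurable_V (b : ℝ) {u : Pt n → ℝ≥0∞} (hu : Measurable u) :
    Measurable (fun q : Pt n => fmx volume b (fun y : Spc n => u (q.1, y)) q.2) :=
  measurable_fmx_param (volume : Measure (Spc n)) b (P := ℝ) (u := fun s y => u (s, y)) hu

lemma measurable_FM (a b : ℝ) {u : Pt n → ℝ≥0∞} (hu : Measurable u) : Measurable (FM a b u) := by
  have h1 := measurable_V b hu
  have h2 := measurable_fmx_param (volume : Measure ℝ) a (P := Spc n)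
    (u := fun x s => fmx volume b (fun y : Spc n => u (s, y)) x) (by
      simpa only [Function.comp_def, Function.uncurry_def, Prod.fst_swap, Prod.snd_swap] using h1.comp (measurable_swap : Measurable (Prod.swap : Spc n × ℝ → ℝ × Spc n)))
  have h3 := h2.comp (measurable_swap : Measurable (Prod.swap : ℝ × Spc n → Spc n × ℝ))
  simp only [Function.comp_def, Prod.fst_swap, Prod.snd_swap] at h3
  unfold FM
  exact h3

lemma tIv_eq (t l : ℝ) : tIv t l = ball t (l/2) := by rw [tIv, Real.ball_eq_Ioo]

lemma measurableSet_cyl (t : ℝ) (x : Spc n) (l r : ℝ) : MeasurableSet (cylinder t x l r) := by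
  unfold _root_.cylinder; rw [tIv_eq]; exact measurableSet_ball.prod measurableSet_ball

lemma isOpen_cyl (t : ℝ) (x : Spc n) (l r : ℝ) : IsOpen (cylinder t x l r) := by
  unfold _root_.cylinder; rw [tIv_eq]; exact isOpen_ball.prod isOpen_ball

lemma vol_cyl (t : ℝ) (x : Spc n) (l r : ℝ) :
    volume (cylinder t x l r) = volume (ball (0:ℝ) (l/2)) * volume (ball (0:Spc n) r) := by
  unfold _root_.cylinder
  rw [tIv_eq, Measure.volume_eq_prod, Measure.prod_prod, meas_ball volume t, meas_ball volume x]

lemma cyl_pos (t : ℝ) (x : Spc n) {l r : ℝ} (hl : 0 < l) (hr : 0 < r) : volume (cylinder t x l r) ≠ 0 := by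
  rw [vol_cyl]
  exact mul_ne_zero (ball0_ne_zero _ (by linarith)) (ball0_ne_zero _ hr)

lemma cyl_ne_top (t : ℝ) (x : Spc n) (l r : ℝ) : volume (cylinder t x l r) ≠ ⊤ := by
  rw [vol_cyl]
  exact ENNReal.mul_ne_top (ball0_ne_top _) (ball0_ne_top _)

lemma cavg_eq (t : ℝ) (x : Spc n) {l r : ℝ} (hl : 0 < l) (hr : 0 < r) {u : Pt n → ℝ≥0∞} (hu : Measurable u) :
    cavg (cylinder t x l r) u =
      av volume (l/2) (fun s : ℝ => av volume r (fun y : Spc n => u (s, y)) x) t := by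
  unfold cavg
  rw [vol_cyl]
  unfold av _root_.cylinder
  rw [tIv_eq, Measure.volume_eq_prod, setLIntegral_prod _ hu.aemeasurable.restrict,
    lintegral_const_mul' _ _ (ENNReal.inv_ne_top.2 (ball0_ne_zero _ hr)),
    ENNReal.mul_inv (Or.inl (ball0_ne_zero _ (by linarith))) (Or.inl (ball0_ne_top _)), mul_assoc]

/-- averages in the space variable with a dilated radius -/
lemma av_dil {E : Type*} [NormedAddCommGroup E] [NormedSpace ℝ E] [MeasurableSpace E] [BorelSpace E]
    [FiniteDimensional ℝ E] (μ : Measure E) [μ.IsAddHaarMeasure] {γ r D : ℝ} (hγ : 1 ≤ γ) (hr : 0 < r) (hD : γ ≤ D)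
    (u : E → ℝ≥0∞) (x : E) :
    av μ (γ * r) u x ≤ ENNReal.ofReal (D ^ Module.finrank ℝ E) * av μ (D * r) u x := by
  have hD0 : 0 < D := by linarith
  have h1 : μ (ball (0:E) (D * r)) ≤ ENNReal.ofReal (D ^ Module.finrank ℝ E) * μ (ball (0:E) (γ * r)) := by
    rw [Measure.addHaar_ball_mul_of_pos μ _ hD0]
    gcongr
    nlinarith
  have hg0 := ball0_ne_zero μ (mul_pos (by linarith : 0 < γ) hr)
  have hgt := ball0_ne_top μ (r := γ * r)
  have hd0 := ball0_ne_zero μ (mul_pos hD0 hr)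
  have hdt := ball0_ne_top μ (r := D * r)
  have h2 : (μ (ball (0:E) (γ * r)))⁻¹ ≤ ENNReal.ofReal (D ^ Module.finrank ℝ E) * (μ (ball (0:E) (D * r)))⁻¹ := by
    rw [← div_eq_mul_inv, ENNReal.le_div_iff_mul_le (Or.inl hd0) (Or.inl hdt), mul_comm, ← div_eq_mul_inv]
    exact ENNReal.div_le_of_le_mul h1
  unfold av
  rw [← mul_assoc]
  gcongr

lemma tail_le {γ : ℝ} (hγ : 1 ≤ γ) {m : ℕ} (hm : γ ≤ 2 ^ m) {a b : ℝ} (ha : 0 ≤ a) (hb : 0 ≤ b)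
    {u : Pt n → ℝ≥0∞} (hu : Measurable u) (t : ℝ) (x : Spc n) (k : ℤ) :
    ENNReal.ofReal (((2:ℝ) ^ k) ^ (2 * a + b)) * tailE γ u t x ((2:ℝ) ^ k) ≤
      ENNReal.ofReal (2 ^ a * ((2:ℝ) ^ m) ^ n) * FM a b u (t, x) := by
  set r : ℝ := (2:ℝ) ^ k with hr
  have hr0 : 0 < r := two_zpos k
  have term : ∀ j : ℕ, ENNReal.ofReal (r ^ (2 * a + b)) * cavg (cylinder t x ((4:ℝ)^j * r^2) (γ * r)) u
      ≤ ENNReal.ofReal (2 ^ a * ((2:ℝ) ^ m) ^ n) * FM a b u (t, x) := by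
    intro j
    have hl : ((4:ℝ)^j * r^2)/2 = (2:ℝ) ^ (2 * (j:ℤ) + 2 * k - 1) := by
      rw [zpow_sub₀ (by norm_num), zpow_add₀ (by norm_num), zpow_mul, zpow_mul' (2:ℝ) 2 k, hr]
      norm_num
    have hρ : (2:ℝ) ^ m * r = (2:ℝ) ^ ((m:ℤ) + k) := by
      rw [zpow_add₀ (by norm_num), hr]; norm_cast
    set l := (2:ℝ) ^ (2 * (j:ℤ) + 2 * k - 1) with hldef
    set ρ := (2:ℝ) ^ ((m:ℤ) + k) with hρdef
    have hl0 : 0 < l := two_zpos _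
    have hρ0 : 0 < ρ := two_zpos _
    rw [cavg_eq t x (by positivity) (by positivity) hu, hl]
    have hdn : Module.finrank ℝ (Spc n) = n := by simp
    have hreal : r ^ (2 * a + b) ≤ 2 ^ a * (l ^ a * ρ ^ b) := by
      rw [Real.rpow_add hr0, ← mul_assoc, ← Real.mul_rpow (by norm_num) hl0.le, Real.rpow_mul hr0.le]
      have h4 : (1:ℝ) ≤ 4 ^ j := one_le_pow₀ (by norm_num)
      have h2m : (1:ℝ) ≤ 2 ^ m := one_le_pow₀ (by norm_num)
      have e1 : r ^ (2:ℝ) ≤ 2 * l := by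
        rw [← hl, Real.rpow_two]; nlinarith [sq_nonneg r]
      have e2 : r ≤ ρ := by rw [← hρ]; nlinarith
      gcongr
    calc ENNReal.ofReal (r ^ (2 * a + b)) *
          av volume l (fun s : ℝ => av volume (γ * r) (fun y : Spc n => u (s, y)) x) t
        ≤ ENNReal.ofReal (2 ^ a * (l ^ a * ρ ^ b)) *
          av volume l (fun s : ℝ => ENNReal.ofReal (((2:ℝ) ^ m) ^ n) * av volume ρ (fun y : Spc n => u (s, y)) x) t := by
          refine mul_le_mul' (ENNReal.ofReal_le_ofReal hreal) (av_mono _ _ (fun s => ?_) _)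
          have := av_dil (volume : Measure (Spc n)) hγ hr0 hm (fun y => u (s, y)) x
          rwa [hdn, hρ] at this
      _ = ENNReal.ofReal (2 ^ a * ((2:ℝ) ^ m) ^ n) * (ENNReal.ofReal (l ^ a) *
          av volume l (fun s : ℝ => ENNReal.ofReal (ρ ^ b) * av volume ρ (fun y : Spc n => u (s, y)) x) t) := by
          rw [av_const_mul _ _ (by simp), av_const_mul _ _ (by simp), ENNReal.ofReal_mul (by positivity),
            ENNReal.ofReal_mul (by positivity), ENNReal.ofReal_mul (by positivity)]
          ring
      _ ≤ _ := by
          gcongr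
          unfold FM
          refine le_trans ?_ (le_iSup _ (2 * (j:ℤ) + 2 * k - 1))
          gcongr
          refine av_mono _ _ (fun s => ?_) _
          exact le_iSup (fun k : ℤ => ENNReal.ofReal (((2:ℝ) ^ k) ^ b) *
            av volume ((2:ℝ) ^ k) (fun y : Spc n => u (s, y)) x) ((m:ℤ) + k)
  unfold tailE
  rw [← ENNReal.tsum_mul_left]
  calc ∑' j : ℕ, ENNReal.ofReal (r ^ (2 * a + b)) * ((2⁻¹ : ℝ≥0∞) ^ (j+1) * cavg (cylinder t x ((4:ℝ)^j * r^2) (γ * r)) u)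
      ≤ ∑' j : ℕ, (2⁻¹ : ℝ≥0∞) ^ (j+1) * (ENNReal.ofReal (2 ^ a * ((2:ℝ) ^ m) ^ n) * FM a b u (t, x)) := by
        refine ENNReal.tsum_le_tsum fun j => ?_
        rw [mul_left_comm]
        exact mul_le_mul_right (term j) _
    _ = _ := by
        rw [ENNReal.tsum_mul_right, ENNReal.tsum_geometric_add_one, ENNReal.one_sub_inv_two, inv_inv,
          ENNReal.inv_mul_cancel (by norm_num) (by norm_num), one_mul]

/-- unweighted tail bound -/
lemma tail_le' {γ : ℝ} (hγ : 1 ≤ γ) {m : ℕ} (hm : γ ≤ 2 ^ m)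
    {u : Pt n → ℝ≥0∞} (hu : Measurable u) (t : ℝ) (x : Spc n) (k : ℤ) :
    tailE γ u t x ((2:ℝ) ^ k) ≤ ENNReal.ofReal (((2:ℝ) ^ m) ^ n) * FM 0 0 u (t, x) := by
  simpa using tail_le hγ hm le_rfl le_rfl hu t x k

/-- parabolic averages are dominated -/
lemma cavg_le {u : Pt n → ℝ≥0∞} (hu : Measurable u) (t : ℝ) (x : Spc n) (k : ℤ) :
    cavg (cylinder t x (((2:ℝ) ^ k)^2) ((2:ℝ) ^ k)) u ≤ FM 0 0 u (t, x) := by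
  have hl : (((2:ℝ) ^ k)^2)/2 = (2:ℝ) ^ (2 * k - 1) := by
    rw [zpow_sub₀ (by norm_num), zpow_mul' (2:ℝ) 2 k]
    norm_num
  rw [cavg_eq t x (by positivity) (by positivity) hu, hl]
  unfold FM
  simp only [fmx_zero]
  refine le_trans ?_ (le_iSup _ (2 * k - 1))
  refine av_mono _ _ (fun s => ?_) _
  exact le_iSup (fun k : ℤ => av volume ((2:ℝ) ^ k) (fun y : Spc n => u (s, y)) x) k

lemma FM_add_le {u v : Pt n → ℝ≥0∞} (hu : Measurable u) (hv : Measurable v) (z : Pt n) :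
    FM 0 0 (fun z => u z + v z) z ≤ FM 0 0 u z + FM 0 0 v z := by
  have h1 := measurable_V 0 hu
  unfold FM
  simp only [fmx_zero] at h1 ⊢
  have h2 : Measurable fun s : ℝ => mx volume (fun y : Spc n => u (s, y)) z.2 :=
    h1.comp (measurable_prodMk_right : Measurable fun s : ℝ => (s, z.2))
  refine le_trans (mx_mono _ (fun s => ?_) _) (mx_add_le _ h2 _)
  exact mx_add_le _ (hu.comp measurable_prodMk_left) _

lemma FM_strong {u : Pt n → ℝ≥0∞} (hu : Measurable u) {p : ℝ} (hp : 1 < p) :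
    ∫⁻ z, FM 0 0 u z ^ p ≤ (3 ^ (n+1) * ENNReal.ofReal (2 ^ p * p / (p-1)) ^ 2) * ∫⁻ z, u z ^ p := by
  have hV := measurable_V 0 hu
  have hF := measurable_FM 0 0 hu
  set c := ENNReal.ofReal (2 ^ p * p / (p-1)) with hc
  calc ∫⁻ z, FM 0 0 u z ^ p = ∫⁻ x : Spc n, ∫⁻ t : ℝ, FM 0 0 u (t, x) ^ p := by
        rw [Measure.volume_eq_prod, lintegral_prod_symm _ (hF.pow_const p).aemeasurable]
    _ ≤ ∫⁻ x : Spc n, (3 * c) * ∫⁻ t : ℝ, mx volume (fun y : Spc n => u (t, y)) x ^ p := by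
        refine lintegral_mono fun x => ?_
        unfold FM
        simp only [fmx_zero] at hV ⊢
        have := strong_type (volume : Measure ℝ)
          (hV.comp (measurable_prodMk_right : Measurable fun s : ℝ => (s, x))) hp
        simpa [Function.comp_def] using this
    _ = (3 * c) * ∫⁻ t : ℝ, ∫⁻ x : Spc n, mx volume (fun y : Spc n => u (t, y)) x ^ p := by
        rw [lintegral_const_mul' _ _ (ENNReal.mul_ne_top (by norm_num) (by simp [hc])),
          lintegral_lintegral_swap]
        simp only [fmx_zero] at hV
        exact ((hV.pow_const p).comp measurable_swap).aemeasurable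
    _ ≤ (3 * c) * ∫⁻ t : ℝ, (3 ^ n * c) * ∫⁻ x : Spc n, u (t, x) ^ p := by
        gcongr with t
        have := strong_type (volume : Measure (Spc n)) (hu.comp (measurable_prodMk_left (x := t))) hp
        simpa [Function.comp_def] using this
    _ = _ := by
        rw [lintegral_const_mul' _ _ (ENNReal.mul_ne_top (by simp) (by simp [hc])),
          Measure.volume_eq_prod, lintegral_prod _ (hu.pow_const p).aemeasurable]
        ring

lemma FM_mixed (hn : 0 < n) {a b qa qb q : ℝ} (ha : 0 ≤ a) (hb : 0 ≤ b) (hqa : 1 < qa) (hqb : 1 < qb)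
    (hq : 0 < q) (h1 : 1/qa - a = 1/q) (h2 : 1/qb - b/(n:ℝ) = 1/q) :
    ∃ C : ℝ≥0∞, C ≠ ⊤ ∧ ∀ u : Pt n → ℝ≥0∞, Measurable u →
      ∫⁻ z, FM a b u z ^ q ≤
        C * (∫⁻ t : ℝ, ((∫⁻ x : Spc n, u (t, x) ^ qb) ^ (1/qb)) ^ qa) ^ (q/qa) := by
  obtain ⟨C₁, hC₁, H₁⟩ := fmx_bound (volume : Measure ℝ) hqa hq ha (by simp) (by simpa using h1)
  obtain ⟨C₂, hC₂, H₂⟩ := fmx_bound (volume : Measure (Spc n)) hqb hq hb (by simpa using hn) (by simpa using h2)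
  have hqa0 : 0 < qa := by linarith
  have hqb0 : 0 < qb := by linarith
  have hr : 1 ≤ q/qa := by
    rw [le_div_iff₀ hqa0, one_mul]
    exact (one_div_le_one_div hq hqa0).1 (by linarith)
  have hrinv : 1/(q/qa) = qa/q := by field_simp
  have hqaq : 0 < qa/q := by positivity
  refine ⟨C₁ * C₂, ENNReal.mul_ne_top hC₁ hC₂, fun u hu => ?_⟩
  have hV := measurable_V b hu
  have hF := measurable_FM a b hu
  set V : ℝ → Spc n → ℝ≥0∞ := fun t x => fmx volume b (fun y : Spc n => u (t, y)) x with hVdef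
  have hVx : ∀ x, Measurable (fun t => V t x) := fun x => by
    simpa only [Function.comp_def] using
      hV.comp (measurable_prodMk_right : Measurable fun s : ℝ => (s, x))
  have hut : ∀ t, Measurable (fun y => u (t, y)) := fun t => by
    simpa only [Function.comp_def] using hu.comp (measurable_prodMk_left (x := t))
  have hVu : Measurable (Function.uncurry fun t x => V t x ^ qa) := by
    simpa only [Function.uncurry_def] using hV.pow_const qa
  calc ∫⁻ z, FM a b u z ^ q = ∫⁻ x : Spc n, ∫⁻ t : ℝ, FM a b u (t, x) ^ q := by
        rw [Measure.volume_eq_prod, lintegral_prod_symm _ (hF.pow_const q).aemeasurable]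
    _ ≤ ∫⁻ x : Spc n, C₁ * (∫⁻ t : ℝ, V t x ^ qa) ^ (q/qa) := by
        refine lintegral_mono fun x => ?_
        exact H₁ (fun t => V t x) (hVx x)
    _ = C₁ * ∫⁻ x : Spc n, (∫⁻ t : ℝ, V t x ^ qa) ^ (q/qa) := lintegral_const_mul' _ _ hC₁
    _ ≤ C₁ * (∫⁻ t : ℝ, (∫⁻ x : Spc n, (V t x ^ qa) ^ (q/qa)) ^ (1/(q/qa))) ^ (q/qa) := by
        gcongr
        exact minkowski (volume : Measure ℝ) (volume : Measure (Spc n)) (K := fun t x => V t x ^ qa)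
          hVu hr
    _ ≤ C₁ * (∫⁻ t : ℝ, C₂ ^ (qa/q) * ((∫⁻ x : Spc n, u (t, x) ^ qb) ^ (1/qb)) ^ qa) ^ (q/qa) := by
        gcongr with t
        have e : ∀ x, (V t x ^ qa) ^ (q/qa) = V t x ^ q := fun x => by
          rw [← ENNReal.rpow_mul]; congr 1; field_simp
        simp_rw [e]
        rw [hrinv]
        calc (∫⁻ x : Spc n, V t x ^ q) ^ (qa/q)
            ≤ (C₂ * (∫⁻ x : Spc n, u (t, x) ^ qb) ^ (q/qb)) ^ (qa/q) := by
              gcongr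
              exact H₂ (fun y => u (t, y)) (hut t)
          _ = _ := by
              rw [ENNReal.mul_rpow_of_nonneg _ _ hqaq.le, ← ENNReal.rpow_mul, ← ENNReal.rpow_mul]
              congr 2; field_simp
    _ = _ := by
        rw [lintegral_const_mul' _ _ (ENNReal.rpow_ne_top_of_nonneg hqaq.le hC₂),
          ENNReal.mul_rpow_of_nonneg _ _ (by linarith), ← ENNReal.rpow_mul,
          show qa/q * (q/qa) = 1 by field_simp, ENNReal.rpow_one, mul_assoc]

end PR
end GT


namespace GT

section RW
variable {n : ℕ}

/-- parabolic cylinder of radius `r` centered at `z` -/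
def pc (z : Pt n) (r : ℝ) : Set (Pt n) := _root_.cylinder z.1 z.2 (r^2) r

/-- dyadic-radius parabolic maximal function -/
noncomputable def PM (u : Pt n → ℝ≥0∞) (z : Pt n) : ℝ≥0∞ :=
  ⨆ k : ℤ, cavg (pc z ((2:ℝ) ^ k)) u

lemma mem_pc {z w : Pt n} {r : ℝ} : w ∈ pc z r ↔ |w.1 - z.1| < r^2/2 ∧ dist w.2 z.2 < r := by
  unfold pc _root_.cylinder
  rw [tIv_eq, mem_prod, mem_ball, mem_ball, Real.dist_eq]

lemma measurableSet_pc (z : Pt n) (r : ℝ) : MeasurableSet (pc z r) := measurableSet_cyl _ _ _ _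

lemma vol_pc (z : Pt n) {r : ℝ} (hr : 0 < r) : volume (pc z r) = ENNReal.ofReal (r^2 * (2*r)^n) := by
  unfold pc
  rw [vol_cyl, Real.volume_ball, Real.volume_pi_ball _ hr, ← ENNReal.ofReal_mul (by positivity)]
  simp [mul_div_cancel₀]

lemma vol_pc_ne_zero (z : Pt n) {r : ℝ} (hr : 0 < r) : volume (pc z r) ≠ 0 := by
  rw [vol_pc z hr]; simp; positivity

lemma vol_pc_ne_top (z : Pt n) (r : ℝ) : volume (pc z r) ≠ ⊤ := cyl_ne_top _ _ _ _

lemma vol_pc_mul (z w : Pt n) {r c : ℝ} (hr : 0 < r) (hc : 0 < c) :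
    volume (pc z (c * r)) = ENNReal.ofReal (c ^ (n+2)) * volume (pc w r) := by
  rw [vol_pc z (by positivity), vol_pc w hr, ← ENNReal.ofReal_mul (by positivity)]
  congr 1
  rw [mul_pow, mul_pow, mul_pow, mul_pow]; ring

lemma measurable_PM {u : Pt n → ℝ≥0∞} (hu : Measurable u) : Measurable (PM u) := by
  refine Measurable.iSup fun k => ?_
  have hk := two_zpos k
  have e : (fun z : Pt n => cavg (pc z ((2:ℝ) ^ k)) u) = fun z : Pt n =>
      av volume (((2:ℝ) ^ k)^2/2) (fun s : ℝ => av volume ((2:ℝ) ^ k) (fun y : Spc n => u (s, y)) z.2) z.1 := by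
    ext z
    exact cavg_eq z.1 z.2 (by positivity) hk hu
  rw [e]
  have h1 := measurable_av (volume : Measure (Spc n)) (P := ℝ) (u := fun s y => u (s, y)) hu ((2:ℝ) ^ k)
  have h2 := measurable_av (volume : Measure ℝ) (P := Spc n)
    (u := fun x s => av volume ((2:ℝ) ^ k) (fun y : Spc n => u (s, y)) x) (by
      simpa only [Function.comp_def, Function.uncurry_def, Prod.fst_swap, Prod.snd_swap] using
        h1.comp (measurable_swap : Measurable (Prod.swap : Spc n × ℝ → ℝ × Spc n))) (((2:ℝ) ^ k)^2/2)
  have h3 := h2.comp (measurable_swap : Measurable (Prod.swap : ℝ × Spc n → Spc n × ℝ))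
  simp only [Function.comp_def, Prod.fst_swap, Prod.snd_swap] at h3
  exact h3

lemma PM_le_FM {u : Pt n → ℝ≥0∞} (hu : Measurable u) (z : Pt n) : PM u z ≤ FM 0 0 u z :=
  iSup_le fun k => cavg_le hu z.1 z.2 k

lemma le_PM (u : Pt n → ℝ≥0∞) (z : Pt n) (k : ℤ) : cavg (pc z ((2:ℝ) ^ k)) u ≤ PM u z :=
  le_iSup (fun k : ℤ => cavg (pc z ((2:ℝ) ^ k)) u) k

lemma cavg_mul_vol {z : Pt n} {r : ℝ} (hr : 0 < r) (u : Pt n → ℝ≥0∞) :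
    cavg (pc z r) u * volume (pc z r) = ∫⁻ w in pc z r, u w := by
  unfold cavg
  rw [mul_comm, ← mul_assoc, ENNReal.mul_inv_cancel (vol_pc_ne_zero z hr) (vol_pc_ne_top z r), one_mul]

/-- Lebesgue differentiation in the form needed. -/
lemma leb {g : Pt n → ℝ} (hg : Measurable g) (h0 : ∀ z, 0 ≤ g z)
    (h2 : ∫⁻ z, ENNReal.ofReal (g z) ^ (2:ℝ) ≠ ⊤) :
    ∀ᵐ z : Pt n, ENNReal.ofReal (g z) ≤ PM (fun z => ENNReal.ofReal (g z)) z := by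
  set G : Pt n → ℝ≥0∞ := fun z => ENNReal.ofReal (g z) with hG
  have hGm : Measurable G := hg.ennreal_ofReal
  have hL : MemLp g 2 volume := by
    refine ⟨hg.aestronglyMeasurable, ?_⟩
    rw [eLpNorm_eq_lintegral_rpow_enorm_toReal (by norm_num) (by norm_num)]
    refine ENNReal.rpow_lt_top_of_nonneg (by simp) ?_
    simp only [ENNReal.toReal_ofNat]
    convert h2 using 3 with z
    rw [Real.enorm_eq_ofReal (h0 z)]
  set Cst : ℝ≥0∞ := 4 * (1 + (3 ^ (n+1) * ENNReal.ofReal (2 ^ (2:ℝ) * 2 / (2-1)) ^ 2)) with hCst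
  have hCt : Cst ≠ ⊤ := by
    rw [hCst]
    exact ENNReal.mul_ne_top (by norm_num) (ENNReal.add_ne_top.2 ⟨by simp,
      ENNReal.mul_ne_top (by simp) (by simp)⟩)
  have hPm := measurable_PM hGm
  have key : ∀ δ : ℝ≥0∞, δ ≠ 0 → ∫⁻ z, (G z - PM G z) ^ (2:ℝ) ≤ Cst * δ ^ (2:ℝ) := by
    intro δ hδ
    obtain ⟨φ, -, hφδ, hφc, hφL⟩ := hL.exists_hasCompactSupport_eLpNorm_sub_le (by norm_num) hδ
    set e : Pt n → ℝ≥0∞ := fun z => ENNReal.ofReal |g z - φ z| with he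
    have hφm : Measurable φ := hφc.measurable
    have hem : Measurable e := by
      have : Measurable fun z => |g z - φ z| := (hg.sub hφm).abs
      exact this.ennreal_ofReal
    have he2 : ∫⁻ z, e z ^ (2:ℝ) ≤ δ ^ (2:ℝ) := by
      rw [eLpNorm_eq_lintegral_rpow_enorm_toReal (by norm_num) (by norm_num)] at hφδ
      simp only [ENNReal.toReal_ofNat] at hφδ
      have h3 := ENNReal.rpow_le_rpow hφδ (by norm_num : (0:ℝ) ≤ 2)
      rw [← ENNReal.rpow_mul] at h3
      norm_num at h3
      refine le_trans (le_of_eq ?_) (by simpa using h3)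
      refine lintegral_congr fun z => ?_
      simp [he, Real.enorm_eq_ofReal_abs]
    have hφG : ∀ y, ENNReal.ofReal (φ y) ≤ G y + e y := fun y => by
      rw [hG, he]
      simp only
      rw [← ENNReal.ofReal_add (h0 y) (abs_nonneg _)]
      refine ENNReal.ofReal_le_ofReal ?_
      have := neg_abs_le (g y - φ y)
      linarith
    have hGφ : ∀ y, G y ≤ ENNReal.ofReal (φ y) + e y := fun y => by
      rw [hG, he]
      refine le_trans (ENNReal.ofReal_le_ofReal ?_) ENNReal.ofReal_add_le
      have := le_abs_self (g y - φ y)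
      linarith
    have hpt : ∀ z, G z - PM G z ≤ FM 0 0 e z + e z := by
      intro z
      rw [tsub_le_iff_left, ← add_assoc]
      refine (hGφ z).trans (add_le_add_left ?_ _)
      refine le_trans ?_ (add_le_add_right (PM_le_FM hem z) _)
      refine ENNReal.le_of_forall_pos_le_add fun ε hε _ => ?_
      have hcont := Metric.continuous_iff.1 hφc z ε (by exact_mod_cast hε)
      obtain ⟨η, hη, hηφ⟩ := hcont
      obtain ⟨N, hN⟩ := exists_pow_lt_of_lt_one (lt_min hη one_pos) (by norm_num : (1/2:ℝ) < 1)
      set k : ℤ := -(N:ℤ) with hk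
      have hr : (2:ℝ) ^ k < min η 1 := by
        rw [hk, zpow_neg, zpow_natCast]; simpa using hN
      have hr0 := two_zpos k
      set r := (2:ℝ) ^ k
      have hsub : ∀ w ∈ pc z r, φ z - ε ≤ φ w := by
        intro w hw
        rw [mem_pc] at hw
        have hd : dist w z < η := by
          rw [Prod.dist_eq]
          refine max_lt ?_ (hw.2.trans (hr.trans_le (min_le_left _ _)))
          rw [Real.dist_eq]
          have h1 : r < η := hr.trans_le (min_le_left _ _)
          have h2 : r < 1 := hr.trans_le (min_le_right _ _)
          nlinarith [hw.1]
        have := hηφ w hd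
        rw [Real.dist_eq, abs_lt] at this
        linarith [this.1]
      have h5 : ENNReal.ofReal (φ z) ≤ ENNReal.ofReal (φ z - ε) + ε := by
        have : φ z = (φ z - ε) + ε := by ring
        conv_lhs => rw [this]
        refine ENNReal.ofReal_add_le.trans (le_of_eq ?_)
        simp
      refine h5.trans (add_le_add_left ?_ _)
      have h6 : ENNReal.ofReal (φ z - ε) * volume (pc z r) ≤ (PM G z + PM e z) * volume (pc z r) := by
        calc ENNReal.ofReal (φ z - ε) * volume (pc z r) = ∫⁻ w in pc z r, ENNReal.ofReal (φ z - ε) := by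
              rw [setLIntegral_const]
          _ ≤ ∫⁻ w in pc z r, G w + e w := by
              refine setLIntegral_mono_ae' (measurableSet_pc z r) (Eventually.of_forall fun w hw => ?_)
              exact (ENNReal.ofReal_le_ofReal (hsub w hw)).trans (hφG w)
          _ = (cavg (pc z r) G + cavg (pc z r) e) * volume (pc z r) := by
              rw [lintegral_add_left hGm, add_mul, cavg_mul_vol hr0, cavg_mul_vol hr0]
          _ ≤ _ := by
              gcongr
              · exact le_PM G z k
              · exact le_PM e z k
      exact (ENNReal.mul_le_mul_iff_left (vol_pc_ne_zero z hr0) (vol_pc_ne_top z r)).1 h6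
    calc ∫⁻ z, (G z - PM G z) ^ (2:ℝ) ≤ ∫⁻ z, 4 * (FM 0 0 e z ^ (2:ℝ) + e z ^ (2:ℝ)) := by
          refine lintegral_mono fun z => ?_
          refine (ENNReal.rpow_le_rpow (hpt z) (by norm_num)).trans ?_
          have hmax : FM 0 0 e z + e z ≤ 2 * max (FM 0 0 e z) (e z) := by
            rw [two_mul]; exact add_le_add (le_max_left _ _) (le_max_right _ _)
          refine (ENNReal.rpow_le_rpow hmax (by norm_num)).trans ?_
          rw [ENNReal.mul_rpow_of_nonneg _ _ (by norm_num),
            show (2:ℝ≥0∞) ^ (2:ℝ) = 4 by rw [ENNReal.rpow_two]; norm_num]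
          gcongr
          rcases max_choice (FM 0 0 e z) (e z) with h | h <;> rw [h]
          · exact le_self_add
          · exact le_add_self
      _ = 4 * ((∫⁻ z, FM 0 0 e z ^ (2:ℝ)) + (∫⁻ z, e z ^ (2:ℝ))) := by
          rw [lintegral_const_mul' _ _ (by norm_num), lintegral_add_right _ (hem.pow_const _)]
      _ ≤ 4 * ((3 ^ (n+1) * ENNReal.ofReal (2 ^ (2:ℝ) * 2 / (2-1)) ^ 2) * (∫⁻ z, e z ^ (2:ℝ))
            + (∫⁻ z, e z ^ (2:ℝ))) := by
          refine mul_le_mul_right (add_le_add_left ?_ _) _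
          exact FM_strong hem (by norm_num : (1:ℝ) < 2)
      _ = Cst * (∫⁻ z, e z ^ (2:ℝ)) := by rw [hCst]; ring
      _ ≤ _ := by gcongr
  have hzero : ∫⁻ z, (G z - PM G z) ^ (2:ℝ) = 0 := by
    have hlim : Tendsto (fun m : ℕ => Cst * ((m:ℝ≥0∞)⁻¹) ^ (2:ℝ)) atTop (𝓝 0) := by
      have h1 : Tendsto (fun m : ℕ => ((m:ℝ≥0∞)⁻¹) ^ (2:ℝ)) atTop (𝓝 (0 ^ (2:ℝ))) :=
        (ENNReal.continuous_rpow_const.tendsto _).comp ENNReal.tendsto_inv_nat_nhds_zero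
      rw [ENNReal.zero_rpow_of_pos (by norm_num)] at h1
      simpa using ENNReal.Tendsto.const_mul h1 (Or.inr hCt)
    refine le_antisymm (ge_of_tendsto' hlim fun m => key _ (by simp)) zero_le
  have hmeas : Measurable fun z => (G z - PM G z) ^ (2:ℝ) := (hGm.sub hPm).pow_const _
  have hzero := (lintegral_eq_zero_iff hmeas).1 hzero
  filter_upwards [hzero] with z hz
  simp only [Pi.zero_apply, ENNReal.rpow_eq_zero_iff] at hz
  rcases hz with hz | hz
  · exact tsub_eq_zero_iff_le.1 hz.1
  · norm_num at hz

lemma rev_weak {u : Pt n → ℝ≥0∞} (hu : Measurable u) (hut : ∫⁻ z, u z ≠ ⊤) {l : ℝ≥0∞} (hl0 : l ≠ 0)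
    (hlt : l ≠ ⊤) :
    ∫⁻ z in {z | l < PM u z}, u z ≤ 4 ^ (n+2) * (l * volume {z : Pt n | l < 2 ^ (n+2) * PM u z}) := by
  -- radii are bounded above
  obtain ⟨K, hK⟩ : ∃ K : ℕ, ∀ (z : Pt n) (k : ℤ), l < cavg (pc z ((2:ℝ)^k)) u → k ≤ K := by
    have hfin : (∫⁻ z, u z) / l ≠ ⊤ := ENNReal.div_ne_top hut hl0
    obtain ⟨N, hN⟩ := ENNReal.exists_nat_gt hfin
    refine ⟨N, fun z k hk => ?_⟩
    by_contra hcon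
    rw [not_le] at hcon
    obtain ⟨m, rfl⟩ : ∃ m : ℕ, k = m := ⟨k.toNat, (Int.toNat_of_nonneg (by omega)).symm⟩
    have hm : N < m := by exact_mod_cast hcon
    have hr0 := two_zpos (m:ℤ)
    have hvol : (N:ℝ≥0∞) ≤ volume (pc z ((2:ℝ)^(m:ℤ))) := by
      rw [vol_pc z hr0, ← ENNReal.ofReal_natCast]
      refine ENNReal.ofReal_le_ofReal ?_
      rw [zpow_natCast]
      have h1 : (1:ℝ) ≤ 2 ^ m := one_le_pow₀ (by norm_num)
      have h2 : (N:ℝ) ≤ 2 ^ m := by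
        have h3 : N < 2 ^ m := hm.trans Nat.lt_two_pow_self
        exact_mod_cast h3.le
      have h3 : (1:ℝ) ≤ (2 * 2 ^ m) ^ n := one_le_pow₀ (by linarith)
      nlinarith
    have h1 : l * volume (pc z ((2:ℝ)^(m:ℤ))) ≤ ∫⁻ z, u z := by
      calc l * volume (pc z ((2:ℝ)^(m:ℤ))) ≤ cavg (pc z ((2:ℝ)^(m:ℤ))) u * volume (pc z ((2:ℝ)^(m:ℤ))) := by
            gcongr
        _ = ∫⁻ w in pc z ((2:ℝ)^(m:ℤ)), u w := cavg_mul_vol hr0 u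
        _ ≤ _ := setLIntegral_le_lintegral _ _
    have h2 : (∫⁻ z, u z) < N * l := by
      rwa [ENNReal.div_lt_iff (Or.inl hl0) (Or.inl hlt)] at hN
    have h3 : (N:ℝ≥0∞) * l ≤ l * volume (pc z ((2:ℝ)^(m:ℤ))) := by rw [mul_comm]; gcongr
    exact absurd (h2.trans_le (h3.trans h1)) (lt_irrefl _)
  set F := {z : Pt n | l < PM u z} with hF
  have hch : ∀ z : Pt n, ∃ k : ℤ, z ∈ F → (l < cavg (pc z ((2:ℝ)^k)) u ∧
      ∀ k', l < cavg (pc z ((2:ℝ)^k')) u → k' ≤ k) := by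
    intro z
    by_cases hz : z ∈ F
    · have hz' := hz
      rw [hF, mem_ofPred_eq, PM, lt_iSup_iff] at hz'
      obtain ⟨k, hk1, hk2⟩ := Int.exists_greatest_of_bdd (P := fun k => l < cavg (pc z ((2:ℝ)^k)) u)
        ⟨K, fun k hk => hK z k hk⟩ hz'
      exact ⟨k, fun _ => ⟨hk1, hk2⟩⟩
    · exact ⟨0, fun h => absurd h hz⟩
  choose k hk using hch
  have hself : ∀ (z : Pt n) (j : ℤ), z ∈ pc z ((2:ℝ)^j) := fun z j => by
    rw [mem_pc]; have := two_zpos j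
    simp only [dist_self, sub_self, abs_zero]
    constructor <;> positivity
  obtain ⟨v, hvF, hdisj, hcov⟩ := Vitali.exists_disjoint_subfamily_covering_enlargement
    (fun z : Pt n => pc z ((2:ℝ) ^ (k z))) F (fun z => (2:ℝ) ^ (k z)) 2 (by norm_num)
    (fun z _ => (two_zpos _).le) ((2:ℝ) ^ (K:ℤ))
    (fun z hz => zpow_le_zpow_right₀ (by norm_num) (hK z _ (hk z hz).1))
    (fun z hz => ⟨z, hself z _⟩)
  have hvc : v.Countable := hdisj.countable_of_isOpen (fun _ _ => isOpen_cyl _ _ _ _)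
    (fun z _ => ⟨z, hself z _⟩)
  have : Countable v := hvc.to_subtype
  have hsub : F ⊆ ⋃ b : v, pc (b : Pt n) ((2:ℝ) ^ (k b + 2)) := by
    intro z hz
    obtain ⟨b, hb, ⟨y, hy1, hy2⟩, hle⟩ := hcov z hz
    refine mem_iUnion.2 ⟨⟨b, hb⟩, ?_⟩
    simp only at hy1 hy2 hle ⊢
    rw [mem_pc] at hy1 hy2 ⊢
    have hz0 := two_zpos (k z)
    have hb0 := two_zpos (k b)
    rw [zpow_add₀ (by norm_num)]
    norm_num
    constructor
    · have h1 := abs_sub_le z.1 y.1 b.1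
      rw [abs_sub_comm z.1 y.1] at h1
      nlinarith [hy1.1, hy2.1]
    · have h1 := dist_triangle_left z.2 b.2 y.2
      linarith [hy1.2, hy2.2]
  have hbig : ∀ b ∈ v, pc b ((2:ℝ) ^ (k b)) ⊆ {z : Pt n | l < 2 ^ (n+2) * PM u z} := by
    intro b hb w hw
    rw [mem_ofPred_eq]
    set r := (2:ℝ) ^ (k b) with hr
    have hr0 : 0 < r := two_zpos _
    have hsub2 : pc b r ⊆ pc w (2 * r) := by
      intro y hy
      rw [mem_pc] at hw hy ⊢
      constructor
      · have h1 := abs_sub_le y.1 b.1 w.1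
        rw [abs_sub_comm b.1 w.1] at h1
        nlinarith [hw.1, hy.1]
      · have h1 := dist_triangle_right y.2 w.2 b.2
        linarith [hw.2, hy.2]
    have h1 : cavg (pc b r) u * volume (pc b r) ≤ (2 ^ (n+2) * cavg (pc w (2*r)) u) * volume (pc b r) := by
      rw [cavg_mul_vol hr0]
      calc ∫⁻ y in pc b r, u y ≤ ∫⁻ y in pc w (2*r), u y := lintegral_mono_set hsub2
        _ = cavg (pc w (2*r)) u * volume (pc w (2*r)) := (cavg_mul_vol (by positivity) u).symm
        _ = _ := by
          rw [vol_pc_mul w b hr0 (by norm_num), ENNReal.ofReal_pow (by norm_num)]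
          simp only [ENNReal.ofReal_ofNat]; ring
    have h2 := (ENNReal.mul_le_mul_iff_left (vol_pc_ne_zero b hr0) (vol_pc_ne_top b r)).1 h1
    refine (hk b (hvF hb)).1.trans_le (h2.trans ?_)
    gcongr
    have h3 : 2 * r = (2:ℝ) ^ (k b + 1) := by rw [zpow_add₀ (by norm_num), hr]; ring
    rw [h3]
    exact le_PM u w _
  calc ∫⁻ z in F, u z ≤ ∫⁻ z in ⋃ b : v, pc (b : Pt n) ((2:ℝ) ^ (k b + 2)), u z := lintegral_mono_set hsub
    _ ≤ ∑' b : v, ∫⁻ z in pc (b : Pt n) ((2:ℝ) ^ (k b + 2)), u z := lintegral_iUnion_le _ _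
    _ ≤ ∑' b : v, (4 ^ (n+2) * l) * volume (pc (b : Pt n) ((2:ℝ) ^ (k b))) := by
        refine ENNReal.tsum_le_tsum fun b => ?_
        have hle : cavg (pc (b : Pt n) ((2:ℝ) ^ (k b + 2))) u ≤ l := by
          by_contra hcon
          rw [not_le] at hcon
          have := (hk b (hvF b.2)).2 _ hcon
          omega
        rw [← cavg_mul_vol (two_zpos _)]
        have h3 : (2:ℝ) ^ (k b + 2) = 4 * (2:ℝ) ^ (k b) := by
          rw [zpow_add₀ (by norm_num)]; norm_num; ring
        calc _ ≤ l * volume (pc (b : Pt n) ((2:ℝ) ^ (k b + 2))) := by gcongr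
          _ = _ := by
            rw [h3, vol_pc_mul _ (b : Pt n) (two_zpos _) (by norm_num), ENNReal.ofReal_pow (by norm_num)]
            simp only [ENNReal.ofReal_ofNat]; ring
    _ = (4 ^ (n+2) * l) * volume (⋃ b ∈ v, pc (b : Pt n) ((2:ℝ) ^ (k b))) := by
        rw [ENNReal.tsum_mul_left, measure_biUnion hvc hdisj (fun _ _ => measurableSet_pc _ _)]
    _ ≤ (4 ^ (n+2) * l) * volume {z : Pt n | l < 2 ^ (n+2) * PM u z} := by
        gcongr
        exact iUnion₂_subset hbig
    _ = _ := by ring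

lemma rev_strong {u : Pt n → ℝ≥0∞} (hu : Measurable u) (hut : ∫⁻ z, u z ≠ ⊤) {θ : ℝ} (hθ : 0 < θ)
    {K : ℝ≥0∞} (hK : K ≠ ⊤) :
    ∫⁻ z, u z * min (PM u z) K ^ θ ≤
      (4 ^ (n+2) * (2 ^ (n+2)) ^ (1 + θ) * ENNReal.ofReal θ) * ∫⁻ z, min (PM u z) K ^ (1 + θ) := by
  have hPm := measurable_PM hu
  have hm : Measurable fun z => min (PM u z) K := hPm.min measurable_const
  have hm2 : Measurable fun z => min (2 ^ (n+2) * PM u z) K := (hPm.const_mul _).min measurable_const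
  set ν := (volume : Measure (Pt n)).withDensity u with hν
  have h1θ : 0 < 1 + θ := by linarith
  have hpow : ((2:ℝ≥0∞) ^ (n+2)) ≠ ⊤ := by simp
  have one_le : (1:ℝ≥0∞) ≤ 2 ^ (n+2) := one_le_pow₀ (by norm_num)
  calc ∫⁻ z, u z * min (PM u z) K ^ θ = ∫⁻ z, min (PM u z) K ^ θ ∂ν := by
        rw [hν, lintegral_withDensity_eq_lintegral_mul _ hu (hm.pow_const θ)]; rfl
    _ = ∫⁻ t in Ioi (0:ℝ), ν {z | ENNReal.ofReal t < min (PM u z) K} * ENNReal.ofReal (θ * t ^ (θ-1)) :=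
        lc ν hm hθ
    _ ≤ ∫⁻ t in Ioi (0:ℝ), (4 ^ (n+2) * ENNReal.ofReal θ) *
          (volume {z : Pt n | ENNReal.ofReal t < min (2 ^ (n+2) * PM u z) K} *
            ENNReal.ofReal ((1+θ) * t ^ (1 + θ-1))) := by
        refine setLIntegral_mono_ae' measurableSet_Ioi (Eventually.of_forall fun t ht => ?_)
        rw [mem_Ioi] at ht
        by_cases hKt : ENNReal.ofReal t < K
        · have e1 : {z : Pt n | ENNReal.ofReal t < min (PM u z) K} = {z | ENNReal.ofReal t < PM u z} := by
            ext z; simp [hKt]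
          have e2 : {z : Pt n | ENNReal.ofReal t < min (2 ^ (n+2) * PM u z) K} =
              {z | ENNReal.ofReal t < 2 ^ (n+2) * PM u z} := by
            ext z; simp [hKt]
          rw [e1, e2, hν, withDensity_apply _ (measurableSet_lt measurable_const hPm)]
          have hw := rev_weak hu hut (l := ENNReal.ofReal t) (by simpa using ht) (by simp)
          set W := volume {z : Pt n | ENNReal.ofReal t < 2 ^ (n+2) * PM u z}
          calc _ ≤ (4 ^ (n+2) * (ENNReal.ofReal t * W)) * ENNReal.ofReal (θ * t ^ (θ-1)) := by gcongr
            _ = (4 ^ (n+2) * W) * ENNReal.ofReal (t * (θ * t ^ (θ-1))) := by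
                rw [ENNReal.ofReal_mul ht.le]; ring
            _ ≤ (4 ^ (n+2) * W) * ENNReal.ofReal (θ * ((1+θ) * t ^ (1 + θ-1))) := by
                refine mul_le_mul_right (ENNReal.ofReal_le_ofReal ?_) _
                have : t ^ (1 + θ - 1) = t ^ (θ-1) * t := by
                  rw [← Real.rpow_add_one ht.ne']; ring_nf
                rw [this]
                have h0 : 0 ≤ t ^ (θ-1) := Real.rpow_nonneg ht.le _
                have h1 : 0 ≤ t * (θ * t ^ (θ-1)) := by positivity
                nlinarith
            _ = _ := by rw [ENNReal.ofReal_mul hθ.le]; ring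
        · have e1 : {z : Pt n | ENNReal.ofReal t < min (PM u z) K} = ∅ := by
            ext z; simp only [lt_min_iff, hKt, and_false, mem_ofPred_eq, mem_empty_iff_false]
          rw [e1]; simp
    _ = (4 ^ (n+2) * ENNReal.ofReal θ) * ∫⁻ z, min (2 ^ (n+2) * PM u z) K ^ (1 + θ) := by
        rw [lintegral_const_mul' _ _ (ENNReal.mul_ne_top (by simp) (by simp)), lc volume hm2 h1θ]
    _ ≤ (4 ^ (n+2) * ENNReal.ofReal θ) * ∫⁻ z, (2 ^ (n+2)) ^ (1 + θ) * min (PM u z) K ^ (1 + θ) := by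
        gcongr with z
        rw [← ENNReal.mul_rpow_of_nonneg _ _ h1θ.le]
        gcongr
        rw [mul_min]
        refine min_le_min le_rfl ?_
        calc K = 1 * K := (one_mul K).symm
          _ ≤ _ := by gcongr
    _ = _ := by
        rw [lintegral_const_mul' _ _ (ENNReal.rpow_ne_top_of_nonneg h1θ.le hpow)]
        ring

end RW
end GT


namespace GT

variable {n : ℕ}

lemma add_rpow_le (x y : ℝ≥0∞) {p : ℝ} (hp : 0 ≤ p) (hp3 : p ≤ 3) :
    (x + y) ^ p ≤ 8 * (x ^ p + y ^ p) := by
  have hmax : x + y ≤ 2 * max x y := by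
    rw [two_mul]; exact add_le_add (le_max_left _ _) (le_max_right _ _)
  refine (ENNReal.rpow_le_rpow hmax hp).trans ?_
  rw [ENNReal.mul_rpow_of_nonneg _ _ hp]
  have h8 : (2:ℝ≥0∞) ^ p ≤ 8 := by
    calc (2:ℝ≥0∞) ^ p ≤ (2:ℝ≥0∞) ^ (3:ℝ) := ENNReal.rpow_le_rpow_of_exponent_le (by norm_num) hp3
      _ = 8 := by
        rw [show (3:ℝ) = ((3:ℕ):ℝ) by norm_num, ENNReal.rpow_natCast]; norm_num
  refine mul_le_mul' h8 ?_
  rcases max_choice x y with h | h <;> rw [h]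
  · exact le_self_add
  · exact le_add_self

lemma cavg_sq {z : Pt n} {r : ℝ} (hr : 0 < r) {u : Pt n → ℝ≥0∞} (hu : Measurable u) :
    cavg (pc z r) u ≤ cavg (pc z r) (fun z => u z ^ (2:ℝ)) ^ (1/2:ℝ) := by
  have h := ENNReal.lintegral_mul_le_Lp_mul_Lq (volume.restrict (pc z r)) (Real.HolderConjugate.two_two)
    (f := u) (g := fun _ => 1) hu.aemeasurable aemeasurable_const
  simp only [Pi.mul_apply, mul_one, ENNReal.one_rpow, lintegral_const, one_mul, Measure.restrict_apply_univ] at h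
  unfold cavg
  set V := volume (pc z r)
  have hV0 : V ≠ 0 := vol_pc_ne_zero z hr
  have hVt : V ≠ ⊤ := vol_pc_ne_top z r
  rw [ENNReal.mul_rpow_of_nonneg _ _ (by norm_num : (0:ℝ) ≤ 1/2)]
  calc V⁻¹ * ∫⁻ w in pc z r, u w ≤ V⁻¹ * ((∫⁻ w in pc z r, u w ^ (2:ℝ)) ^ (1/2:ℝ) * V ^ (1/2:ℝ)) := by
        exact mul_le_mul_right h _
    _ = (V⁻¹ * V ^ (1/2:ℝ)) * (∫⁻ w in pc z r, u w ^ (2:ℝ)) ^ (1/2:ℝ) := by ring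
    _ = _ := by
        congr 1
        rw [← ENNReal.rpow_neg_one, ← ENNReal.rpow_add _ _ hV0 hVt, ← ENNReal.rpow_mul]
        norm_num

lemma PM_sq {u : Pt n → ℝ≥0∞} (hu : Measurable u) (z : Pt n) :
    PM u z ≤ PM (fun z => u z ^ (2:ℝ)) z ^ (1/2:ℝ) := by
  refine iSup_le fun k => (cavg_sq (two_zpos k) hu).trans ?_
  exact ENNReal.rpow_le_rpow (le_PM _ z k) (by norm_num)

lemma min_add_le' (x y k : ℝ≥0∞) : min (x + y) k ≤ min x k + y := by
  rcases le_total x k with h | h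
  · rw [min_eq_left h]; exact min_le_left _ _
  · rw [min_eq_right h]; exact (min_le_right _ _).trans le_self_add

lemma min_rpow' (x y : ℝ≥0∞) {p : ℝ} (hp : 0 ≤ p) : min x y ^ p = min (x ^ p) (y ^ p) :=
  (ENNReal.monotone_rpow_of_nonneg hp).map_min

lemma core (A : ℝ≥0∞) (hA : A ≠ ⊤) :
    ∃ ε : ℝ, 0 < ε ∧ ε ≤ 1 ∧ ∃ C : ℝ≥0∞, C ≠ ⊤ ∧ ∀ p : ℝ, 2 < p → p < 2 + ε →
      ∀ (g : Pt n → ℝ) (R : Pt n → ℝ≥0∞), Measurable g → (∀ z, 0 ≤ g z) → Measurable R →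
        ∫⁻ z, ENNReal.ofReal (g z) ^ (2:ℝ) ≠ ⊤ →
        (∀ z, PM (fun z => ENNReal.ofReal (g z) ^ (2:ℝ)) z ^ (1/2:ℝ) ≤
          A * FM 0 0 (fun z => ENNReal.ofReal (g z)) z + R z) →
        ∫⁻ z, ENNReal.ofReal (g z) ^ p ≤ C * ∫⁻ z, R z ^ p := by
  set D : ℝ≥0∞ := 4 ^ (n+2) * (2 ^ (n+2)) ^ 2 with hD
  have hDt : D ≠ ⊤ := ENNReal.mul_ne_top (by simp) (by simp)
  set M : ℝ≥0∞ := 3 ^ (n+1) * ENNReal.ofReal 24 ^ 2 with hM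
  have hMt : M ≠ ⊤ := ENNReal.mul_ne_top (by simp) (by simp)
  set B : ℝ≥0∞ := (1 + A) ^ 3 with hB
  have hBt : B ≠ ⊤ := by simp [hB, hA]
  set L : ℝ≥0∞ := D * (8 * (8 * (2 * (B * M)))) with hL
  have hLt : L ≠ ⊤ := by
    refine ENNReal.mul_ne_top hDt (ENNReal.mul_ne_top (by simp) (ENNReal.mul_ne_top (by simp)
      (ENNReal.mul_ne_top (by simp) (ENNReal.mul_ne_top hBt hMt))))
  have hLr : 0 ≤ L.toReal := ENNReal.toReal_nonneg
  refine ⟨min 1 (1 / (L.toReal + 1)), by positivity, min_le_left _ _, 16 * D,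
    ENNReal.mul_ne_top (by simp) hDt, ?_⟩
  intro p hp2 hpε g R hg hg0 hR hG2 hH
  have hp3 : p ≤ 3 := by have := min_le_left 1 (1 / (L.toReal + 1)); linarith
  have hpL : p - 2 < 1 / (L.toReal + 1) := by have := min_le_right 1 (1 / (L.toReal + 1)); linarith
  set θ : ℝ := p / 2 - 1 with hθ
  have hθ0 : 0 < θ := by rw [hθ]; linarith
  have hθ1 : θ ≤ 1 := by rw [hθ]; linarith
  have hLθ : L * ENNReal.ofReal θ ≤ 1/2 := by
    rw [← ENNReal.ofReal_toReal hLt, ← ENNReal.ofReal_mul hLr,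
      show (1/2:ℝ≥0∞) = ENNReal.ofReal (1/2) by
        rw [ENNReal.ofReal_div_of_pos (by norm_num)]; norm_num]
    refine ENNReal.ofReal_le_ofReal ?_
    have h1 : (L.toReal + 1) * (p-2) < 1 := by
      rwa [lt_div_iff₀ (by positivity), mul_comm] at hpL
    rw [hθ]; nlinarith
  set G : Pt n → ℝ≥0∞ := fun z => ENNReal.ofReal (g z) with hG
  have hGm : Measurable G := hg.ennreal_ofReal
  have hGt : ∀ z, G z ≠ ⊤ := fun z => ENNReal.ofReal_ne_top
  set w : Pt n → ℝ≥0∞ := PM (fun z => G z ^ (2:ℝ)) with hw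
  have hG2m : Measurable fun z => G z ^ (2:ℝ) := hGm.pow_const _
  have hwm : Measurable w := measurable_PM hG2m
  have hae : ∀ᵐ z, G z ≤ w z ^ (1/2:ℝ) := by
    filter_upwards [leb hg hg0 hG2] with z hz
    exact hz.trans (PM_sq hGm z)
  have hAB : ∀ q : ℝ, 0 ≤ q → q ≤ 3 → A ^ q ≤ B := by
    intro q hq0 hq3
    calc A ^ q ≤ (1 + A) ^ q := ENNReal.rpow_le_rpow le_add_self hq0
      _ ≤ (1 + A) ^ (3:ℝ) := ENNReal.rpow_le_rpow_of_exponent_le le_self_add hq3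
      _ = B := by
        rw [show (3:ℝ) = ((3:ℕ):ℝ) by norm_num, ENNReal.rpow_natCast]
  have hFMs : ∀ (u : Pt n → ℝ≥0∞), Measurable u → ∀ q : ℝ, 2 ≤ q → q ≤ 3 →
      ∫⁻ z, (A * FM 0 0 u z) ^ q ≤ (B * M) * ∫⁻ z, u z ^ q := by
    intro u hu q hq2 hq3
    calc ∫⁻ z, (A * FM 0 0 u z) ^ q = A ^ q * ∫⁻ z, FM 0 0 u z ^ q := by
          rw [← lintegral_const_mul' _ _ (ENNReal.rpow_ne_top_of_nonneg (by linarith) hA)]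
          refine lintegral_congr fun z => ENNReal.mul_rpow_of_nonneg _ _ (by linarith)
      _ ≤ B * ((3 ^ (n+1) * ENNReal.ofReal (2 ^ q * q / (q-1)) ^ 2) * ∫⁻ z, u z ^ q) :=
          mul_le_mul' (hAB q (by linarith) hq3) (FM_strong hu (by linarith))
      _ ≤ B * (M * ∫⁻ z, u z ^ q) := by
          refine mul_le_mul_right (mul_le_mul_left (mul_le_mul_right
            (pow_le_pow_left' (ENNReal.ofReal_le_ofReal ?_) 2) _) _) _
          rw [div_le_iff₀ (by linarith)]
          have : (2:ℝ) ^ q ≤ 8 := by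
            calc (2:ℝ) ^ q ≤ 2 ^ (3:ℝ) := Real.rpow_le_rpow_of_exponent_le (by norm_num) hq3
              _ = 8 := by norm_num
          nlinarith
      _ = _ := by ring
  -- truncated estimate
  have key : ∀ κ : ℝ≥0∞, κ ≠ ⊤ →
      ∫⁻ z, G z ^ (2:ℝ) * min (G z) κ ^ (p-2) ≤ (16 * D) * ∫⁻ z, R z ^ p := by
    intro κ hκ
    set J := ∫⁻ z, G z ^ (2:ℝ) * min (G z) κ ^ (p-2) with hJ
    have hJt : J ≠ ⊤ := by
      have : J ≤ (∫⁻ z, G z ^ (2:ℝ)) * κ ^ (p-2) := by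
        rw [← lintegral_mul_const _ hG2m]
        refine lintegral_mono fun z => mul_le_mul_right (ENNReal.rpow_le_rpow (min_le_right _ _) (by linarith)) _
      exact ne_top_of_le_ne_top (ENNReal.mul_ne_top hG2
        (ENNReal.rpow_ne_top_of_nonneg (by linarith) hκ)) this
    set G1 : Pt n → ℝ≥0∞ := fun z => min (G z) κ with hG1
    set G2 : Pt n → ℝ≥0∞ := fun z => G z - κ with hG2'
    have hG1m : Measurable G1 := hGm.min measurable_const
    have hG2m' : Measurable G2 := hGm.sub measurable_const
    have hsum : G = fun z => G1 z + G2 z := by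
      ext z
      simp only [hG1, hG2']
      rcases le_total (G z) κ with h | h
      · rw [min_eq_left h, tsub_eq_zero_of_le h, add_zero]
      · rw [min_eq_right h, add_tsub_cancel_of_le h]
    set X : Pt n → ℝ≥0∞ := fun z => A * FM 0 0 G z with hX
    set X1 : Pt n → ℝ≥0∞ := fun z => A * FM 0 0 G1 z with hX1
    set X2 : Pt n → ℝ≥0∞ := fun z => A * FM 0 0 G2 z with hX2
    have hX1m : Measurable X1 := (measurable_FM 0 0 hG1m).const_mul _
    have hX2m : Measurable X2 := (measurable_FM 0 0 hG2m').const_mul _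
    have hXle : ∀ z, X z ≤ X2 z + X1 z := by
      intro z
      have := FM_add_le hG1m hG2m' z
      rw [← hsum] at this
      calc X z ≤ A * (FM 0 0 G1 z + FM 0 0 G2 z) := mul_le_mul_right this _
        _ = _ := by rw [mul_add, add_comm]
    have hXp : ∫⁻ z, min (X z) κ ^ p ≤ 8 * (2 * (B * M)) * J := by
      have hpt : ∀ z, min (X z) κ ^ p ≤ 8 * (X2 z ^ (2:ℝ) * κ ^ (p-2) + X1 z ^ p) := by
        intro z
        have h1 : min (X z) κ ≤ min (X2 z) κ + X1 z :=
          (min_le_min_right _ (hXle z)).trans (min_add_le' _ _ _)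
        refine (ENNReal.rpow_le_rpow h1 (by linarith)).trans ?_
        refine (add_rpow_le _ _ (by linarith) hp3).trans ?_
        refine mul_le_mul_right (add_le_add_left ?_ _) _
        calc min (X2 z) κ ^ p = min (X2 z) κ ^ (2:ℝ) * min (X2 z) κ ^ (p-2) := by
              rw [← ENNReal.rpow_add_of_nonneg _ _ (by norm_num) (by linarith)]; congr 1; ring
          _ ≤ _ := mul_le_mul' (ENNReal.rpow_le_rpow (min_le_left _ _) (by norm_num))
            (ENNReal.rpow_le_rpow (min_le_right _ _) (by linarith))
      have hb1 : ∫⁻ z, X1 z ^ p ≤ (B * M) * J := by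
        refine (hFMs G1 hG1m p hp2.le hp3).trans (mul_le_mul_right (lintegral_mono fun z => ?_) _)
        calc G1 z ^ p = G1 z ^ (2:ℝ) * G1 z ^ (p-2) := by
              rw [← ENNReal.rpow_add_of_nonneg _ _ (by norm_num) (by linarith)]; congr 1; ring
          _ ≤ _ := mul_le_mul_left (ENNReal.rpow_le_rpow (min_le_left _ _) (by norm_num)) _
      have hb2 : (∫⁻ z, X2 z ^ (2:ℝ)) * κ ^ (p-2) ≤ (B * M) * J := by
        calc (∫⁻ z, X2 z ^ (2:ℝ)) * κ ^ (p-2) ≤ ((B * M) * ∫⁻ z, G2 z ^ (2:ℝ)) * κ ^ (p-2) :=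
              mul_le_mul_left (hFMs G2 hG2m' 2 le_rfl (by norm_num)) _
          _ = (B * M) * ∫⁻ z, G2 z ^ (2:ℝ) * κ ^ (p-2) := by
              rw [lintegral_mul_const _ (hG2m'.pow_const _)]; ring
          _ ≤ _ := by
              refine mul_le_mul_right (lintegral_mono fun z => ?_) _
              simp only [hG2']
              rcases le_total (G z) κ with h | h
              · rw [tsub_eq_zero_of_le h, ENNReal.zero_rpow_of_pos (by norm_num), zero_mul]
                exact zero_le
              · rw [min_eq_right h]
                exact mul_le_mul_left (ENNReal.rpow_le_rpow tsub_le_self (by norm_num)) _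
      calc ∫⁻ z, min (X z) κ ^ p ≤ ∫⁻ z, 8 * (X2 z ^ (2:ℝ) * κ ^ (p-2) + X1 z ^ p) := lintegral_mono hpt
        _ = 8 * ((∫⁻ z, X2 z ^ (2:ℝ)) * κ ^ (p-2) + ∫⁻ z, X1 z ^ p) := by
            rw [lintegral_const_mul' _ _ (by norm_num), lintegral_add_right _ (hX1m.pow_const _),
              lintegral_mul_const _ (hX2m.pow_const _)]
        _ ≤ 8 * ((B * M) * J + (B * M) * J) := mul_le_mul_right (add_le_add hb2 hb1) _
        _ = _ := by ring
    have hmin : ∀ z, min (w z) (κ ^ (2:ℝ)) ^ (1 + θ) ≤ 8 * (min (X z) κ ^ p + R z ^ p) := by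
      intro z
      have e : min (w z) (κ ^ (2:ℝ)) ^ (1 + θ) = min (w z ^ (1/2:ℝ)) κ ^ p := by
        rw [min_rpow' _ _ (by linarith : (0:ℝ) ≤ 1+θ), min_rpow' _ _ (by linarith : (0:ℝ) ≤ p),
          ← ENNReal.rpow_mul, ← ENNReal.rpow_mul]
        congr 2 <;> rw [hθ] <;> ring
      rw [e]
      refine (ENNReal.rpow_le_rpow ((min_le_min_right _ (hH z)).trans (min_add_le' _ _ _)) (by linarith)).trans ?_
      exact add_rpow_le _ _ (by linarith) hp3
    have hmain : J ≤ J / 2 + (8 * D) * ∫⁻ z, R z ^ p := by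
      calc J ≤ ∫⁻ z, G z ^ (2:ℝ) * min (w z) (κ ^ (2:ℝ)) ^ θ := by
            refine lintegral_mono_ae ?_
            filter_upwards [hae] with z hz
            refine mul_le_mul_right ?_ _
            have e : min (w z) (κ ^ (2:ℝ)) ^ θ = min (w z ^ (1/2:ℝ)) κ ^ (p-2) := by
              rw [min_rpow' _ _ hθ0.le, min_rpow' _ _ (by linarith : (0:ℝ) ≤ p-2),
                ← ENNReal.rpow_mul, ← ENNReal.rpow_mul]
              congr 2 <;> rw [hθ] <;> ring
            rw [e]
            exact ENNReal.rpow_le_rpow (min_le_min_right _ hz) (by linarith)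
        _ ≤ (4 ^ (n+2) * (2 ^ (n+2)) ^ (1 + θ) * ENNReal.ofReal θ) *
              ∫⁻ z, min (w z) (κ ^ (2:ℝ)) ^ (1 + θ) :=
            rev_strong hG2m hG2 hθ0 (ENNReal.rpow_ne_top_of_nonneg (by norm_num) hκ)
        _ ≤ (D * ENNReal.ofReal θ) * (8 * (8 * (2 * (B * M)) * J + ∫⁻ z, R z ^ p)) := by
            refine mul_le_mul' (mul_le_mul_left (mul_le_mul_right ?_ _) _) ?_
            · rw [← ENNReal.rpow_two]
              refine ENNReal.rpow_le_rpow_of_exponent_le (one_le_pow₀ (by norm_num)) (by linarith)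
            · calc ∫⁻ z, min (w z) (κ ^ (2:ℝ)) ^ (1 + θ) ≤ ∫⁻ z, 8 * (min (X z) κ ^ p + R z ^ p) :=
                    lintegral_mono hmin
                _ = 8 * ((∫⁻ z, min (X z) κ ^ p) + ∫⁻ z, R z ^ p) := by
                    rw [lintegral_const_mul' _ _ (by norm_num), lintegral_add_right _ (hR.pow_const _)]
                _ ≤ _ := mul_le_mul_right (add_le_add_left hXp _) _
        _ = (L * ENNReal.ofReal θ) * J + ENNReal.ofReal θ * ((8 * D) * ∫⁻ z, R z ^ p) := by
            rw [hL]; ring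
        _ ≤ (1/2) * J + 1 * ((8 * D) * ∫⁻ z, R z ^ p) := by
            refine add_le_add (mul_le_mul_left hLθ _) (mul_le_mul_left ?_ _)
            exact ENNReal.ofReal_le_one.2 hθ1
        _ = _ := by rw [one_mul, ENNReal.div_eq_inv_mul, ENNReal.div_eq_inv_mul, mul_one]
    have h2 : J / 2 ≤ (8 * D) * ∫⁻ z, R z ^ p := by
      have h3 : J / 2 + J / 2 ≤ J / 2 + (8 * D) * ∫⁻ z, R z ^ p := by rwa [ENNReal.add_halves]
      exact (ENNReal.add_le_add_iff_left (ENNReal.div_ne_top hJt (by norm_num))).1 h3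
    calc J = J / 2 + J / 2 := (ENNReal.add_halves J).symm
      _ ≤ _ := add_le_add h2 h2
      _ = _ := by ring
  calc ∫⁻ z, G z ^ p ≤ ∫⁻ z, ⨆ N : ℕ, G z ^ (2:ℝ) * min (G z) N ^ (p-2) := by
        refine lintegral_mono fun z => ?_
        obtain ⟨N, hN⟩ := ENNReal.exists_nat_gt (hGt z)
        refine le_trans ?_ (le_iSup (fun N : ℕ => G z ^ (2:ℝ) * min (G z) N ^ (p-2)) N)
        rw [min_eq_left hN.le, ← ENNReal.rpow_add_of_nonneg _ _ (by norm_num) (by linarith)]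
        refine le_of_eq ?_; congr 1; ring
    _ = ⨆ N : ℕ, ∫⁻ z, G z ^ (2:ℝ) * min (G z) N ^ (p-2) := by
        refine lintegral_iSup (fun N => hG2m.mul ((hGm.min measurable_const).pow_const _)) ?_
        intro N M hNM z
        refine mul_le_mul_right (ENNReal.rpow_le_rpow (min_le_min_left _ (by exact_mod_cast hNM)) (by linarith)) _
    _ ≤ _ := iSup_le fun N => key N (by simp)

end GT


namespace GT

variable {n : ℕ}

lemma mid (hn : 0 < n) (A : ℝ≥0∞) (hA : A ≠ ⊤) {γ : ℝ} (hγ : 1 ≤ γ) :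
    ∃ ε : ℝ, 0 < ε ∧ ∀ s p a b qa qb : ℝ, 1 < s → 2 < p → p < 2 + ε → 0 ≤ a → 0 ≤ b → 1 < qa → 1 < qb →
      2 * a + b = s → 1/qa - a = s/p → 1/qb - b/(n:ℝ) = s/p →
      ∃ C : ℝ≥0∞, C ≠ ⊤ ∧ ∀ (g : Pt n → ℝ) (F2 Hs : Pt n → ℝ≥0∞), Measurable g → (∀ z, 0 ≤ g z) →
        Measurable F2 → Measurable Hs → ∫⁻ z, ENNReal.ofReal (g z) ^ (2:ℝ) ≠ ⊤ →
        (∀ (z : Pt n) (k : ℤ), cavg (pc z ((2:ℝ) ^ k)) (fun z => ENNReal.ofReal (g z) ^ (2:ℝ)) ^ (1/2:ℝ) ≤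
          A * tailE γ (fun z => ENNReal.ofReal (g z)) z.1 z.2 ((2:ℝ) ^ k) +
          tailE γ F2 z.1 z.2 ((2:ℝ) ^ k) ^ (1/2:ℝ) +
          ENNReal.ofReal ((2:ℝ) ^ k) * tailE γ Hs z.1 z.2 ((2:ℝ) ^ k) ^ (1/s)) →
        ∫⁻ z, ENNReal.ofReal (g z) ^ p ≤ C * ((∫⁻ z, F2 z ^ (p/2)) +
          (∫⁻ t : ℝ, ((∫⁻ x : Spc n, Hs (t, x) ^ qb) ^ (1/qb)) ^ qa) ^ ((p/s)/qa)) := by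
  obtain ⟨m, hm⟩ : ∃ m : ℕ, γ ≤ 2 ^ m := by
    obtain ⟨m, hm⟩ := pow_unbounded_of_one_lt γ (by norm_num : (1:ℝ) < 2)
    exact ⟨m, hm.le⟩
  set c : ℝ≥0∞ := ENNReal.ofReal (((2:ℝ) ^ m) ^ n) with hc
  have hct : c ≠ ⊤ := ENNReal.ofReal_ne_top
  obtain ⟨ε, hε, hε1, C₀, hC₀, H⟩ := core (n := n) (A * c) (ENNReal.mul_ne_top hA hct)
  refine ⟨ε, hε, ?_⟩
  intro s p a b qa qb hs hp2 hpε ha hb hqa hqb hab h1 h2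
  have hps : 0 < p / s := by positivity
  obtain ⟨C₁, hC₁, H₁⟩ := FM_mixed hn ha hb hqa hqb hps (by rw [h1, one_div_div]) (by rw [h2, one_div_div])
  set c' : ℝ≥0∞ := ENNReal.ofReal (2 ^ a * ((2:ℝ) ^ m) ^ n) with hc'
  have hct' : c' ≠ ⊤ := ENNReal.ofReal_ne_top
  set M : ℝ≥0∞ := 3 ^ (n+1) * ENNReal.ofReal (2 ^ (p/2) * (p/2) / (p/2-1)) ^ 2 with hM
  have hMt : M ≠ ⊤ := ENNReal.mul_ne_top (by simp) (by simp)
  set K1 : ℝ≥0∞ := c ^ (p/2) * M with hK1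
  set K2 : ℝ≥0∞ := c' ^ (p/s) * C₁ with hK2
  have hK1t : K1 ≠ ⊤ := ENNReal.mul_ne_top (ENNReal.rpow_ne_top_of_nonneg (by linarith) hct) hMt
  have hK2t : K2 ≠ ⊤ := ENNReal.mul_ne_top (ENNReal.rpow_ne_top_of_nonneg hps.le hct') hC₁
  refine ⟨C₀ * (8 * (K1 + K2)), ENNReal.mul_ne_top hC₀ (ENNReal.mul_ne_top (by simp) (by simp [hK1t, hK2t])), ?_⟩
  intro g F2 Hs hg hg0 hF hHs hG2 hyp
  have hFm := measurable_FM 0 0 hF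
  have hHm := measurable_FM a b hHs
  have hm1 : Measurable fun z => (c * FM 0 0 F2 z) ^ (1/2:ℝ) := (hFm.const_mul _).pow_const _
  have hm2 : Measurable fun z => (c' * FM a b Hs z) ^ (1/s:ℝ) := (hHm.const_mul _).pow_const _
  have hR := hm1.add hm2
  have hmain := H p hp2 hpε g (fun z => (c * FM 0 0 F2 z) ^ (1/2:ℝ) + (c' * FM a b Hs z) ^ (1/s:ℝ)) hg hg0
    hR hG2 ?_
  · refine hmain.trans ?_
    rw [mul_assoc C₀]
    refine mul_le_mul_right ?_ _
    set P := ∫⁻ z, F2 z ^ (p/2)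
    set Q := (∫⁻ t : ℝ, ((∫⁻ x : Spc n, Hs (t, x) ^ qb) ^ (1/qb)) ^ qa) ^ ((p/s)/qa)
    have hI1 : ∫⁻ z, ((c * FM 0 0 F2 z) ^ (1/2:ℝ)) ^ p ≤ K1 * P := by
      calc ∫⁻ z, ((c * FM 0 0 F2 z) ^ (1/2:ℝ)) ^ p = ∫⁻ z, c ^ (p/2) * FM 0 0 F2 z ^ (p/2) := by
            refine lintegral_congr fun z => ?_
            rw [← ENNReal.rpow_mul, ← ENNReal.mul_rpow_of_nonneg _ _ (by linarith)]
            congr 1; ring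
        _ = c ^ (p/2) * ∫⁻ z, FM 0 0 F2 z ^ (p/2) :=
            lintegral_const_mul' _ _ (ENNReal.rpow_ne_top_of_nonneg (by linarith) hct)
        _ ≤ c ^ (p/2) * (M * P) := mul_le_mul_right (FM_strong hF (by linarith)) _
        _ = _ := by rw [hK1]; ring
    have hI2 : ∫⁻ z, ((c' * FM a b Hs z) ^ (1/s:ℝ)) ^ p ≤ K2 * Q := by
      calc ∫⁻ z, ((c' * FM a b Hs z) ^ (1/s:ℝ)) ^ p = ∫⁻ z, c' ^ (p/s) * FM a b Hs z ^ (p/s) := by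
            refine lintegral_congr fun z => ?_
            rw [← ENNReal.rpow_mul, ← ENNReal.mul_rpow_of_nonneg _ _ hps.le]
            congr 1; ring
        _ = c' ^ (p/s) * ∫⁻ z, FM a b Hs z ^ (p/s) :=
            lintegral_const_mul' _ _ (ENNReal.rpow_ne_top_of_nonneg hps.le hct')
        _ ≤ c' ^ (p/s) * (C₁ * Q) := mul_le_mul_right (H₁ Hs hHs) _
        _ = _ := by rw [hK2]; ring
    calc ∫⁻ z, ((c * FM 0 0 F2 z) ^ (1/2:ℝ) + (c' * FM a b Hs z) ^ (1/s:ℝ)) ^ p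
        ≤ ∫⁻ z, 8 * (((c * FM 0 0 F2 z) ^ (1/2:ℝ)) ^ p + ((c' * FM a b Hs z) ^ (1/s:ℝ)) ^ p) :=
          lintegral_mono fun z => add_rpow_le _ _ (by linarith) (by linarith)
      _ = 8 * ((∫⁻ z, ((c * FM 0 0 F2 z) ^ (1/2:ℝ)) ^ p) + ∫⁻ z, ((c' * FM a b Hs z) ^ (1/s:ℝ)) ^ p) := by
          rw [lintegral_const_mul' _ _ (by norm_num), lintegral_add_left (hm1.pow_const _)]
      _ ≤ 8 * (K1 * P + K2 * Q) := mul_le_mul_right (add_le_add hI1 hI2) _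
      _ ≤ 8 * ((K1 + K2) * P + (K1 + K2) * Q) := by
          refine mul_le_mul_right (add_le_add (mul_le_mul_left le_self_add _) (mul_le_mul_left le_add_self _)) _
      _ = _ := by ring
  · intro z
    have hG : Measurable fun z => ENNReal.ofReal (g z) := hg.ennreal_ofReal
    have hsup : PM (fun z => ENNReal.ofReal (g z) ^ (2:ℝ)) z ≤
        (A * c * FM 0 0 (fun z => ENNReal.ofReal (g z)) z +
          ((c * FM 0 0 F2 z) ^ (1/2:ℝ) + (c' * FM a b Hs z) ^ (1/s:ℝ))) ^ (2:ℝ) := by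
      refine iSup_le fun k => ?_
      have e : cavg (pc z ((2:ℝ) ^ k)) (fun z => ENNReal.ofReal (g z) ^ (2:ℝ)) =
          (cavg (pc z ((2:ℝ) ^ k)) (fun z => ENNReal.ofReal (g z) ^ (2:ℝ)) ^ (1/2:ℝ)) ^ (2:ℝ) := by
        rw [← ENNReal.rpow_mul]; norm_num
      rw [e]
      refine ENNReal.rpow_le_rpow ((hyp z k).trans ?_) (by norm_num)
      rw [add_assoc]
      refine add_le_add ?_ (add_le_add ?_ ?_)
      · rw [mul_assoc]
        exact mul_le_mul_right (tail_le' hγ hm hG z.1 z.2 k) _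
      · exact ENNReal.rpow_le_rpow (tail_le' hγ hm hF z.1 z.2 k) (by norm_num)
      · have h3 := tail_le hγ hm ha hb hHs z.1 z.2 k
        rw [hab] at h3
        have hr := two_zpos k
        have hs0 : (0:ℝ) ≤ 1/s := by positivity
        refine le_trans (le_of_eq ?_) (ENNReal.rpow_le_rpow h3 hs0)
        rw [ENNReal.mul_rpow_of_nonneg _ _ hs0, ← ENNReal.ofReal_rpow_of_pos hr, ← ENNReal.rpow_mul,
          mul_one_div_cancel (by linarith), ENNReal.rpow_one]
    refine (ENNReal.rpow_le_rpow hsup (by norm_num : (0:ℝ) ≤ 1/2)).trans (le_of_eq ?_)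
    rw [← ENNReal.rpow_mul]; norm_num

lemma cavg_congr {S : Set (Pt n)} {u v : Pt n → ℝ≥0∞} (h : u =ᵐ[volume] v) : cavg S u = cavg S v := by
  unfold cavg
  rw [lintegral_congr_ae (ae_restrict_of_ae h)]

lemma tailE_congr {γ : ℝ} {u v : Pt n → ℝ≥0∞} (h : u =ᵐ[volume] v) (t : ℝ) (x : Spc n) (r : ℝ) :
    tailE γ u t x r = tailE γ v t x r := by
  unfold tailE
  refine tsum_congr fun j => ?_
  rw [cavg_congr h]

lemma ofReal_avg_le {S : Set (Pt n)} (h0 : volume S ≠ 0) (ht : volume S ≠ ⊤) {u : Pt n → ℝ} (hu : ∀ z, 0 ≤ u z) :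
    ENNReal.ofReal (⨍ z in S, u z) ≤ cavg S (fun z => ENNReal.ofReal (u z)) := by
  unfold cavg
  rw [setAverage_eq, smul_eq_mul, ENNReal.ofReal_mul (by positivity), Measure.real, ENNReal.ofReal_inv_of_pos
    (ENNReal.toReal_pos h0 ht), ENNReal.ofReal_toReal ht]
  refine mul_le_mul_right ?_ _
  by_cases hi : IntegrableOn u S
  · rw [ofReal_integral_eq_lintegral_ofReal hi (Eventually.of_forall hu)]
  · rw [integral_undef hi]; simp

lemma ofReal_avg_eq {S : Set (Pt n)} (h0 : volume S ≠ 0) (ht : volume S ≠ ⊤) {u : Pt n → ℝ} (hu : ∀ z, 0 ≤ u z)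
    (hi : Integrable u) :
    ENNReal.ofReal (⨍ z in S, u z) = cavg S (fun z => ENNReal.ofReal (u z)) := by
  unfold cavg
  rw [setAverage_eq, smul_eq_mul, ENNReal.ofReal_mul (by positivity), Measure.real, ENNReal.ofReal_inv_of_pos
    (ENNReal.toReal_pos h0 ht), ENNReal.ofReal_toReal ht,
    ofReal_integral_eq_lintegral_ofReal hi.integrableOn (Eventually.of_forall hu)]

lemma avg_nonneg (S : Set (Pt n)) {u : Pt n → ℝ} (hu : ∀ z, 0 ≤ u z) : 0 ≤ ⨍ z in S, u z := by
  rw [setAverage_eq, smul_eq_mul]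
  exact mul_nonneg (by positivity) (integral_nonneg hu)

lemma tailAvg_nonneg (γ : ℝ) {u : Pt n → ℝ} (hu : ∀ z, 0 ≤ u z) (t : ℝ) (x : Spc n) (r : ℝ) :
    0 ≤ tailAvg γ u t x r :=
  tsum_nonneg fun j => mul_nonneg (by positivity) (avg_nonneg _ hu)

lemma ofReal_tailAvg_le {γ : ℝ} (hγ : 1 ≤ γ) {u : Pt n → ℝ} (hu : ∀ z, 0 ≤ u z) (t : ℝ) (x : Spc n)
    {r : ℝ} (hr : 0 < r) :
    ENNReal.ofReal (tailAvg γ u t x r) ≤ tailE γ (fun z => ENNReal.ofReal (u z)) t x r := by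
  unfold tailAvg tailE
  by_cases hs : Summable fun j : ℕ => ((2:ℝ)⁻¹) ^ (j+1) * ⨍ z in _root_.cylinder t x ((4:ℝ)^j * r^2) (γ * r), u z
  · rw [ENNReal.ofReal_tsum_of_nonneg (fun j => mul_nonneg (by positivity) (avg_nonneg _ hu)) hs]
    refine ENNReal.tsum_le_tsum fun j => ?_
    rw [ENNReal.ofReal_mul (by positivity)]
    refine mul_le_mul' (le_of_eq ?_) (ofReal_avg_le (cyl_pos _ _ (by positivity) (by positivity))
      (cyl_ne_top _ _ _ _) hu)
    rw [ENNReal.ofReal_pow (by positivity), ENNReal.ofReal_inv_of_pos (by norm_num)]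
    norm_num
  · rw [tsum_eq_zero_of_not_summable hs]; simp

lemma pnormE_eq {g : Pt n → ℝ} (hg : ∀ z, 0 ≤ g z) {p : ℝ} (hp : 0 < p) :
    pnormE g p = (∫⁻ z, ENNReal.ofReal (g z) ^ p) ^ (1/p) := by
  unfold pnormE
  rw [eLpNorm_eq_lintegral_rpow_enorm_toReal (by simpa using hp) (by simp), ENNReal.toReal_ofReal hp.le]
  simp_rw [fun z => Real.enorm_of_nonneg (hg z)]

theorem final (n : ℕ) (hn : 0 < n) (A₀ : ℝ) (hA : 1 ≤ A₀) (γ : ℝ) (hγ : 1 < γ) :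
    ∃ ε : ℝ, 0 < ε ∧
      ∀ (s p a b qa qb : ℝ),
        1 < s → s < (n : ℝ) + 2 →
        2 < p → p < 2 + ε →
        0 ≤ a → 0 ≤ b → 1 < qa → 1 < qb →
        2 * a + b = s → 1/qa - a = s/p → 1/qb - b/(n:ℝ) = s/p →
        ∃ C : ℝ, 0 < C ∧
          ∀ g f h : Pt n → ℝ,
            (∀ z, 0 ≤ g z) → (∀ z, 0 ≤ f z) → (∀ z, 0 ≤ h z) →
            Integrable (fun z => g z ^ 2) →
            Integrable (fun z => f z ^ 2) →
            Integrable (fun z => h z ^ s) →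
            (∀ (t₀ : ℝ) (x₀ : Spc n) (r : ℝ), 0 < r →
              (⨍ z in _root_.cylinder t₀ x₀ (r^2) r, g z ^ 2) ^ (1/2 : ℝ)
                ≤ A₀ * tailAvg γ g t₀ x₀ r
                  + (tailAvg γ (fun z => f z ^ 2) t₀ x₀ r) ^ (1/2 : ℝ)
                  + r * (tailAvg γ (fun z => h z ^ s) t₀ x₀ r) ^ (1/s)) →
            pnormE g p
              ≤ ENNReal.ofReal C *
                (pnormE f p + (mixedNorm (fun z => h z ^ s) qa qb) ^ (1/s)) := by
  obtain ⟨ε, hε, H⟩ := mid hn (ENNReal.ofReal A₀) ENNReal.ofReal_ne_top hγ.le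
  refine ⟨ε, hε, ?_⟩
  intro s p a b qa qb hs _ hp2 hpε ha hb hqa hqb hab h1 h2
  obtain ⟨C, hC, H⟩ := H s p a b qa qb hs hp2 hpε ha hb hqa hqb hab h1 h2
  have hp0 : 0 < p := by linarith
  have hCp : C ^ (1/p) ≠ ⊤ := ENNReal.rpow_ne_top_of_nonneg (by positivity) hC
  refine ⟨(C ^ (1/p)).toReal + 1, by positivity, ?_⟩
  intro g f h hg hf hh ig iff ih hyp
  -- measurable representatives
  have agm : AEMeasurable g := by
    have : g = fun z => Real.sqrt (g z ^ 2) := by ext z; rw [Real.sqrt_sq (hg z)]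
    rw [this]
    exact Real.continuous_sqrt.measurable.comp_aemeasurable ig.aemeasurable
  set g' : Pt n → ℝ := fun z => |agm.mk g z| with hg'
  have hg'm : Measurable g' := agm.measurable_mk.abs
  have hgg : g =ᵐ[volume] g' := by
    filter_upwards [agm.ae_eq_mk] with z hz
    rw [hg']; simp only; rw [← hz, abs_of_nonneg (hg z)]
  have afm := iff.aemeasurable
  have ahm := ih.aemeasurable
  set F2 : Pt n → ℝ≥0∞ := fun z => ENNReal.ofReal (afm.mk _ z) with hF2
  set Hs : Pt n → ℝ≥0∞ := fun z => ENNReal.ofReal (ahm.mk _ z) with hHs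
  have hF2m : Measurable F2 := afm.measurable_mk.ennreal_ofReal
  have hHsm : Measurable Hs := ahm.measurable_mk.ennreal_ofReal
  have hFF : (fun z => ENNReal.ofReal (f z ^ 2)) =ᵐ[volume] F2 := by
    filter_upwards [afm.ae_eq_mk] with z hz
    rw [hF2]; simp only; rw [← hz]
  have hHH : (fun z => ENNReal.ofReal (h z ^ s)) =ᵐ[volume] Hs := by
    filter_upwards [ahm.ae_eq_mk] with z hz
    rw [hHs]; simp only; rw [← hz]
  have hGG : (fun z => ENNReal.ofReal (g z)) =ᵐ[volume] fun z => ENNReal.ofReal (g' z) := by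
    filter_upwards [hgg] with z hz
    rw [hz]
  have hsq : ∀ z, ENNReal.ofReal (g z ^ 2) = ENNReal.ofReal (g z) ^ (2:ℝ) := by
    intro z; rw [ENNReal.ofReal_pow (hg z), ENNReal.rpow_two]
  have hGG2 : (fun z => ENNReal.ofReal (g z ^ 2)) =ᵐ[volume] fun z => ENNReal.ofReal (g' z) ^ (2:ℝ) := by
    filter_upwards [hgg] with z hz
    rw [hsq, hz]
  have hfin : ∫⁻ z, ENNReal.ofReal (g' z) ^ (2:ℝ) ≠ ⊤ := by
    rw [← lintegral_congr_ae hGG2, ← ofReal_integral_eq_lintegral_ofReal ig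
      (Eventually.of_forall fun z => sq_nonneg _)]
    exact ENNReal.ofReal_ne_top
  have hmain := H g' F2 Hs hg'm (fun z => abs_nonneg _) hF2m hHsm hfin ?_
  · -- take roots
    have hPf : ∫⁻ z, F2 z ^ (p/2) = pnormE f p ^ p := by
      rw [pnormE_eq hf hp0, ← ENNReal.rpow_mul, one_div_mul_cancel hp0.ne', ENNReal.rpow_one]
      refine lintegral_congr_ae ?_
      filter_upwards [hFF] with z hz
      rw [← hz, ENNReal.ofReal_pow (hf z), ← ENNReal.rpow_two, ← ENNReal.rpow_mul]
      congr 1; ring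
    have hHs' : ∀ᵐ t : ℝ, ∀ᵐ x : Spc n, ENNReal.ofReal (h (t, x) ^ s) = Hs (t, x) := by
      have := hHH
      rw [Measure.volume_eq_prod] at this
      exact Measure.ae_ae_of_ae_prod this
    have hMx : (∫⁻ t : ℝ, ((∫⁻ x : Spc n, Hs (t, x) ^ qb) ^ (1/qb)) ^ qa) ^ ((p/s)/qa) =
        (mixedNorm (fun z => h z ^ s) qa qb ^ (1/s)) ^ p := by
      unfold mixedNorm
      rw [← ENNReal.rpow_mul, ← ENNReal.rpow_mul]
      congr 1
      · refine lintegral_congr_ae ?_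
        filter_upwards [hHs'] with t ht
        congr 2
        refine lintegral_congr_ae ?_
        filter_upwards [ht] with x hx
        rw [← hx, abs_of_nonneg (Real.rpow_nonneg (hh _) _)]
      · ring
    rw [hPf, hMx] at hmain
    set P := pnormE f p
    set Q := mixedNorm (fun z => h z ^ s) qa qb ^ (1/s)
    rw [pnormE_eq hg hp0, lintegral_congr_ae (g := fun z => ENNReal.ofReal (g' z) ^ p)
      (by filter_upwards [hGG] with z hz; rw [hz])]
    calc (∫⁻ z, ENNReal.ofReal (g' z) ^ p) ^ (1/p) ≤ (C * (P + Q) ^ p) ^ (1/p) := by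
          refine ENNReal.rpow_le_rpow (hmain.trans (mul_le_mul_right ?_ _)) (by positivity)
          exact ENNReal.add_rpow_le_rpow_add P Q (by linarith)
      _ = C ^ (1/p) * (P + Q) := by
          rw [ENNReal.mul_rpow_of_nonneg _ _ (by positivity), ← ENNReal.rpow_mul,
            mul_one_div_cancel hp0.ne', ENNReal.rpow_one]
      _ ≤ _ := by
          refine mul_le_mul_left ?_ _
          rw [ENNReal.le_ofReal_iff_toReal_le hCp (by positivity)]
          linarith
  · intro z k
    have hr := two_zpos k
    have h3 := ENNReal.ofReal_le_ofReal (hyp z.1 z.2 _ hr)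
    have hf2 : ∀ z, 0 ≤ f z ^ 2 := fun z => sq_nonneg _
    have hhs : ∀ z, 0 ≤ h z ^ s := fun z => Real.rpow_nonneg (hh z) _
    have hg2 : ∀ z, 0 ≤ g z ^ 2 := fun z => sq_nonneg _
    rw [← ENNReal.ofReal_rpow_of_nonneg (avg_nonneg _ hg2) (by norm_num),
      ofReal_avg_eq (cyl_pos _ _ (by positivity) hr) (cyl_ne_top _ _ _ _) hg2 ig,
      cavg_congr hGG2] at h3
    refine h3.trans ?_
    refine ENNReal.ofReal_add_le.trans (add_le_add (ENNReal.ofReal_add_le.trans (add_le_add ?_ ?_)) ?_)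
    · rw [ENNReal.ofReal_mul (by linarith), ← tailE_congr hGG]
      exact mul_le_mul_right (ofReal_tailAvg_le hγ.le hg _ _ hr) _
    · rw [← ENNReal.ofReal_rpow_of_nonneg (tailAvg_nonneg _ hf2 _ _ _) (by norm_num), ← tailE_congr hFF]
      exact ENNReal.rpow_le_rpow (ofReal_tailAvg_le hγ.le hf2 _ _ hr) (by norm_num)
    · have hs0 : 0 ≤ 1/s := by positivity
      rw [ENNReal.ofReal_mul hr.le, ← ENNReal.ofReal_rpow_of_nonneg (tailAvg_nonneg _ hhs _ _ _) hs0,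
        ← tailE_congr hHH]
      exact mul_le_mul_right (ENNReal.rpow_le_rpow (ofReal_tailAvg_le hγ.le hhs _ _ hr) hs0) _

end GT


noncomputable section

/-- Gehring type lemma with tail, Lemma `lem:global`. -/
theorem gehring_lemma_with_tail
    (n : ℕ) (hn : 0 < n) (A₀ : ℝ) (hA : 1 ≤ A₀) (γ : ℝ) (hγ : 1 < γ) :
    ∃ ε : ℝ, 0 < ε ∧
      ∀ (s p a b qa qb : ℝ),
        1 < s → s < (n : ℝ) + 2 →
        2 < p → p < 2 + ε →
        0 ≤ a → 0 ≤ b → 1 < qa → 1 < qb →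
        2 * a + b = s → 1/qa - a = s/p → 1/qb - b/(n:ℝ) = s/p →
        ∃ C : ℝ, 0 < C ∧
          ∀ g f h : Pt n → ℝ,
            (∀ z, 0 ≤ g z) → (∀ z, 0 ≤ f z) → (∀ z, 0 ≤ h z) →
            Integrable (fun z => g z ^ 2) →
            Integrable (fun z => f z ^ 2) →
            Integrable (fun z => h z ^ s) →
            -- the reverse Hölder inequality with tail, for all parabolic cylinders
            (∀ (t₀ : ℝ) (x₀ : Spc n) (r : ℝ), 0 < r →
              (⨍ z in cylinder t₀ x₀ (r^2) r, g z ^ 2) ^ (1/2 : ℝ)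
                ≤ A₀ * tailAvg γ g t₀ x₀ r
                  + (tailAvg γ (fun z => f z ^ 2) t₀ x₀ r) ^ (1/2 : ℝ)
                  + r * (tailAvg γ (fun z => h z ^ s) t₀ x₀ r) ^ (1/s)) →
            pnormE g p
              ≤ ENNReal.ofReal C *
                (pnormE f p + (mixedNorm (fun z => h z ^ s) qa qb) ^ (1/s)) := by
  exact GT.final n hn A₀ hA γ hγ

end
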